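/- arXiv:2411.10622 — 3 statements merged into one kernel-verified Lean document; each statement's English description precedes it below -/
import Mathlib

section
/- Kolmogorov–Arnold representation theorem: for every n ≥ 1 and every continuous function f : [0,1]^n → ℝ, there exist continuous functions Φ_q : ℝ → ℝ (for q = 1, …, 2n+1) and continuous functions φ_{q,p} : [0,1] → ℝ (for q = 1, …, 2n+1 and p = 1, …, n) such that for all x = (x_1, …, x_n) ∈ [0,1]^n, f(x_1, …, x_n) = Σ_{q=1}^{2n+1} Φ_q( Σ_{p=1}^{n} φ_{q,p}(x_p) ). -/
namespace KA

lemma extend_near {X ι : Type*} [TopologicalSpace X] [NormalSpace X] [Finite ι]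
    (C : ι → Set X) (hC : ∀ i, IsClosed (C i)) (hd : ∀ i j x, x ∈ C i → x ∈ C j → i = j)
    (φ : C(X, ℝ)) (v : ι → ℝ) (ε : ℝ) (hε : 0 ≤ ε)
    (hv : ∀ i, ∀ x ∈ C i, |v i - φ x| ≤ ε) :
    ∃ ψ : C(X, ℝ), (∀ x, |ψ x - φ x| ≤ ε) ∧ ∀ i, ∀ x ∈ C i, ψ x = v i := by
  classical
  let g : X → ℝ := fun x => if h : ∃ i, x ∈ C i then v h.choose - φ x else 0
  have hg : ∀ i, ∀ x ∈ C i, g x = v i - φ x := by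
    intro i x hx
    have h : ∃ i, x ∈ C i := ⟨i, hx⟩
    have : h.choose = i := hd _ _ x h.choose_spec hx
    simp only [g, dif_pos h, this]
  have hcont : ContinuousOn g (⋃ i, C i) := by
    refine (locallyFinite_of_finite C).continuousOn_iUnion hC (fun i => ?_)
    have : ContinuousOn (fun x => v i - φ x) (C i) := by fun_prop
    exact this.congr (hg i)
  have hcl : IsClosed (⋃ i, C i) := isClosed_iUnion_of_finite hC
  obtain ⟨k, hk, hk2⟩ := ContinuousMap.exists_restrict_eq_forall_mem_of_closed
    (s := ⋃ i, C i) ⟨_, hcont.domRestrict⟩ (t := Set.Icc (-ε) ε) (by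
      rintro ⟨x, hx⟩
      obtain ⟨i, hi⟩ := Set.mem_iUnion.1 hx
      have := hv i x hi
      rw [← hg i x hi] at this
      exact abs_le.1 this) ⟨0, by simp [hε]⟩ hcl
  refine ⟨φ + k, fun x => ?_, fun i x hx => ?_⟩
  · simpa using abs_le.2 (hk x)
  · have h1 := DFunLike.congr_fun hk2 ⟨x, Set.mem_iUnion.2 ⟨i, hx⟩⟩
    have h2 : k x = g x := h1
    simp [h2, hg i x hx]

lemma cells (n : ℕ) (δ : ℝ) (hδ : 0 < δ) :
    ∃ (B : ℕ) (C : Fin (2 * n + 1) → Fin B → Set (Set.Icc (0 : ℝ) 1))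
      (bad : Set.Icc (0 : ℝ) 1 → Fin (2 * n + 1)),
      (∀ q j, IsClosed (C q j)) ∧ (∀ q i j x, x ∈ C q i → x ∈ C q j → i = j) ∧
      (∀ q j, ∀ x ∈ C q j, ∀ y ∈ C q j, dist x y < δ) ∧
      ∀ x q, q ≠ bad x → ∃ j, x ∈ C q j := by
  obtain ⟨N, hN⟩ := exists_nat_gt ((2 * n + 1 : ℝ) / δ)
  have hN0 : (0 : ℝ) < N := lt_of_le_of_lt (by positivity) hN
  have hN1 : (2 * n + 1 : ℝ) < N * δ := (div_lt_iff₀ hδ).1 hN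
  refine ⟨N + (2 * n + 1) + 1, fun q j => {x | ((2 * n + 1) * (j : ℕ) + (q : ℕ) + 1 : ℝ) ≤
      N * (x : ℝ) + (2 * n + 1) ∧ N * (x : ℝ) + (2 * n + 1) ≤
      (2 * n + 1) * (j : ℕ) + (q : ℕ) + (2 * n + 1)},
    fun x => ⟨⌊N * (x : ℝ)⌋₊ % (2 * n + 1), Nat.mod_lt _ (by omega)⟩, ?_, ?_, ?_, ?_⟩
  · intro q j
    beta_reduce
    rw [Set.ofPred_and]
    refine IsClosed.inter ?_ ?_
    · exact isClosed_le (by fun_prop) (by fun_prop)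
    · exact isClosed_le (by fun_prop) (by fun_prop)
  · have key : ∀ (q : Fin (2 * n + 1)) (i j : ℕ) (y : ℝ),
        ((2 * n + 1) * i + (q : ℕ) + 1 : ℝ) ≤ y →
        y ≤ (2 * n + 1) * j + (q : ℕ) + (2 * n + 1) → i ≤ j := by
      intro q i j y h1 h2
      by_contra h
      have h3 : (j : ℝ) + 1 ≤ i := by exact_mod_cast (not_le.1 h)
      have h4 : (0 : ℝ) ≤ 2 * n + 1 := by positivity
      nlinarith
    rintro q i j x ⟨h1, h2⟩ ⟨h3, h4⟩
    exact Fin.ext (le_antisymm (key q _ _ _ h1 h4) (key q _ _ _ h3 h2))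
  · rintro q j x ⟨h1, h2⟩ y ⟨h3, h4⟩
    rw [Subtype.dist_eq, Real.dist_eq, abs_lt]
    constructor <;> nlinarith
  · intro x q hq
    have hx0 : 0 ≤ N * (x : ℝ) := mul_nonneg hN0.le x.2.1
    have hx1 : N * (x : ℝ) ≤ N := by nlinarith [x.2.2]
    have k1 := Nat.floor_le hx0
    have k2 := Nat.lt_floor_add_one (N * (x : ℝ))
    have k3 : ⌊N * (x : ℝ)⌋₊ ≤ N := by
      have := Nat.floor_le_floor hx1
      simpa using this
    have hq' : (q : ℕ) ≠ ⌊N * (x : ℝ)⌋₊ % (2 * n + 1) := fun h => hq (Fin.ext h)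
    generalize ⌊N * (x : ℝ)⌋₊ = k at *
    have hql := q.2
    have e1 := Nat.div_add_mod (k + (2 * n + 1) - q - 1) (2 * n + 1)
    have e2 := Nat.mod_lt (k + (2 * n + 1) - q - 1) (show 2 * n + 1 > 0 by omega)
    have e3 : (k + (2 * n + 1) - q - 1) / (2 * n + 1) ≤ k + (2 * n + 1) - q - 1 :=
      Nat.div_le_self _ _
    have e4 : (k + (2 * n + 1) - q - 1) % (2 * n + 1) ≠ 2 * n := by
      intro h
      apply hq'
      rw [h] at e1
      have e5 : k + (2 * n + 1) =
          q + (2 * n + 1) * ((k + (2 * n + 1) - q - 1) / (2 * n + 1) + 1) := by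
        rw [mul_add]; omega
      have e6 := congrArg (· % (2 * n + 1)) e5
      simp only [Nat.add_mod_right, Nat.add_mul_mod_self_left] at e6
      rw [e6, Nat.mod_eq_of_lt hql]
    refine ⟨⟨(k + (2 * n + 1) - q - 1) / (2 * n + 1), by omega⟩, ?_, ?_⟩
    · have : (2 * n + 1) * ((k + (2 * n + 1) - q - 1) / (2 * n + 1)) + q + 1 ≤
        k + (2 * n + 1) := by omega
      have h' : ((2 * n + 1) * ((k + (2 * n + 1) - q - 1) / (2 * n + 1) : ℕ) + (q : ℕ) + 1 : ℝ) ≤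
        k + (2 * n + 1) := by exact_mod_cast this
      simp only
      linarith
    · have : k + 1 + (2 * n + 1) ≤
        (2 * n + 1) * ((k + (2 * n + 1) - q - 1) / (2 * n + 1)) + q + (2 * n + 1) := by omega
      have h' : (k + 1 + (2 * n + 1) : ℝ) ≤
        (2 * n + 1) * ((k + (2 * n + 1) - q - 1) / (2 * n + 1) : ℕ) + (q : ℕ) + (2 * n + 1) := by
        exact_mod_cast this
      simp only
      linarith

lemma values (n B : ℕ) (a : Fin n → Fin B → ℝ) (ε : ℝ) (hε : 0 < ε) :
    ∃ v : Fin n → Fin B → ℝ, (∀ p j, |v p j - a p j| ≤ ε) ∧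
      Function.Injective (fun J : Fin n → Fin B => ∑ p, v p (J p)) := by
  refine ⟨fun p j => ε / (B : ℝ) ^ n *
    (((B : ℤ) ^ n * ⌊a p j / ε⌋ + ((j : ℕ) * B ^ (p : ℕ) : ℕ) : ℤ) : ℝ), ?_, ?_⟩
  · intro p j
    have hB : (0 : ℝ) < B := by exact_mod_cast j.pos
    have hBn : (0 : ℝ) < (B : ℝ) ^ n := by positivity
    have h1 : (j : ℕ) * B ^ (p : ℕ) ≤ B ^ n := by
      calc (j : ℕ) * B ^ (p : ℕ) ≤ B * B ^ (p : ℕ) := Nat.mul_le_mul_right _ j.2.le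
        _ = B ^ ((p : ℕ) + 1) := by rw [pow_succ, mul_comm]
        _ ≤ B ^ n := Nat.pow_le_pow_right j.pos p.2
    have h1' : ((j : ℕ) * (B : ℝ) ^ (p : ℕ)) ≤ (B : ℝ) ^ n := by exact_mod_cast h1
    have h2 := Int.floor_le (a p j / ε)
    have h3 := Int.lt_floor_add_one (a p j / ε)
    rw [le_div_iff₀ hε] at h2
    rw [div_lt_iff₀ hε] at h3
    have h4 : ε / (B : ℝ) ^ n *
      (((B : ℤ) ^ n * ⌊a p j / ε⌋ + ((j : ℕ) * B ^ (p : ℕ) : ℕ) : ℤ) : ℝ) =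
      ε * ⌊a p j / ε⌋ + ε * (((j : ℕ) * (B : ℝ) ^ (p : ℕ)) / (B : ℝ) ^ n) := by
      push_cast
      field_simp
    have h5 : ((j : ℕ) * (B : ℝ) ^ (p : ℕ)) / (B : ℝ) ^ n ≤ 1 := (div_le_one hBn).2 h1'
    have h6 : 0 ≤ ((j : ℕ) * (B : ℝ) ^ (p : ℕ)) / (B : ℝ) ^ n := by positivity
    beta_reduce
    rw [h4, abs_le]
    constructor <;> nlinarith
  · intro J J' h
    simp only [← Finset.mul_sum] at h
    rcases Nat.eq_zero_or_pos n with rfl | hn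
    · exact Subsingleton.elim _ _
    have hBp : 0 < B := (J ⟨0, hn⟩).pos
    have hB : (0 : ℝ) < B := by exact_mod_cast hBp
    have h1 := mul_left_cancel₀ (by positivity) h
    have h2 : ∑ p, ((B : ℤ) ^ n * ⌊a p (J p) / ε⌋ + ((J p : ℕ) * B ^ (p : ℕ) : ℕ) : ℤ) =
      ∑ p, ((B : ℤ) ^ n * ⌊a p (J' p) / ε⌋ + ((J' p : ℕ) * B ^ (p : ℕ) : ℕ) : ℤ) := by
      exact_mod_cast h1
    simp only [Finset.sum_add_distrib, ← Finset.mul_sum, ← Nat.cast_sum,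
      ← finFunctionFinEquiv_apply] at h2
    have h3 := congrArg (· % ((B : ℤ) ^ n)) h2
    simp only [Int.mul_add_emod_self_left] at h3
    apply (finFunctionFinEquiv (m := B) (n := n)).injective
    apply Fin.ext
    have l1 := (finFunctionFinEquiv J).2
    have l2 := (finFunctionFinEquiv J').2
    rw [Int.emod_eq_of_lt (by positivity) (by exact_mod_cast l1),
      Int.emod_eq_of_lt (by positivity) (by exact_mod_cast l2)] at h3
    exact_mod_cast h3

abbrev I := Set.Icc (0 : ℝ) 1

lemma approx (n : ℕ) (f : C(Fin n → I, ℝ)) (hf : f ≠ 0)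
    (φ : Fin (2 * n + 1) → Fin n → C(I, ℝ)) (ε : ℝ) (hε : 0 < ε) :
    ∃ ψ : Fin (2 * n + 1) → Fin n → C(I, ℝ), (∀ q p x, |ψ q p x - φ q p x| ≤ 2 * ε) ∧
      ∃ h : Fin (2 * n + 1) → C(ℝ, ℝ), (∀ q t, |h q t| ≤ ‖f‖) ∧
        ∀ x, |f x - ∑ q, h q (∑ p, ψ q p (x p))| < (1 - 1 / (2 * (2 * n + 1))) * ‖f‖ := by
  classical
  have hM : 0 < ‖f‖ := norm_pos_iff.2 hf
  set M := ‖f‖ with hMdef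
  have hm : (0 : ℝ) < 2 * n + 1 := by positivity
  have hfu : UniformContinuous f := CompactSpace.uniformContinuous_of_continuous f.continuous
  obtain ⟨δ₁, hδ₁, hfδ⟩ := Metric.uniformContinuous_iff.1 hfu (M / (4 * (2 * n + 1))) (by positivity)
  have hφu : ∃ δ₂ > 0, ∀ q p x y, dist x y < δ₂ → dist (φ q p x) (φ q p y) < ε := by
    have h1 : UniformContinuous (fun x => fun (r : Fin (2 * n + 1) × Fin n) => φ r.1 r.2 x) :=
      CompactSpace.uniformContinuous_of_continuous (by fun_prop)
    obtain ⟨δ, h0, h⟩ := Metric.uniformContinuous_iff.1 h1 ε hε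
    exact ⟨δ, h0, fun q p x y hxy => lt_of_le_of_lt
      (dist_le_pi_dist (fun (r : Fin (2 * n + 1) × Fin n) => φ r.1 r.2 x)
        (fun (r : Fin (2 * n + 1) × Fin n) => φ r.1 r.2 y) (q, p)) (h hxy)⟩
  obtain ⟨δ₂, hδ₂, hφδ⟩ := hφu
  obtain ⟨B, C, bad, hC1, hC2, hC3, hC4⟩ := cells n (min δ₁ δ₂) (lt_min hδ₁ hδ₂)
  have hc : ∃ c : Fin (2 * n + 1) → Fin B → I, ∀ q j, ∀ x ∈ C q j, dist (c q j) x < min δ₁ δ₂ := by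
    refine ⟨fun q j => if h : (C q j).Nonempty then h.some else 0, fun q j x hx => ?_⟩
    have h : (C q j).Nonempty := ⟨x, hx⟩
    simp only [dif_pos h]
    exact hC3 q j _ h.some_mem _ hx
  obtain ⟨c, hc⟩ := hc
  choose v hv1 hv2 using fun q => values n B (fun p j => φ q p (c q j)) ε hε
  have hψ : ∀ q p, ∃ ψ : C(I, ℝ), (∀ x, |ψ x - φ q p x| ≤ 2 * ε) ∧
      ∀ j, ∀ x ∈ C q j, ψ x = v q p j := by
    intro q p
    refine extend_near (C q) (hC1 q) (hC2 q) (φ q p) (v q p) (2 * ε) (by positivity) ?_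
    intro j x hx
    have h1 := hv1 q p j
    have h2 := hφδ q p _ _ ((hc q j x hx).trans_le (min_le_right _ _))
    rw [Real.dist_eq] at h2
    have h3 := abs_sub_le (v q p j) (φ q p (c q j)) (φ q p x)
    linarith
  choose ψ hψ1 hψ2 using hψ
  have hh : ∀ q, ∃ h : C(ℝ, ℝ), (∀ t, |h t| ≤ M / (2 * n + 1)) ∧
      ∀ J : Fin n → Fin B, h (∑ p, v q p (J p)) = f (fun p => c q (J p)) / (2 * n + 1) := by
    intro q
    obtain ⟨h, h1, h2⟩ := extend_near (fun J : Fin n → Fin B => {∑ p, v q p (J p)})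
      (fun J => isClosed_singleton)
      (fun J J' x h1 h2 => hv2 q (by
        simp only [Set.mem_singleton_iff] at h1 h2
        exact h1.symm.trans h2))
      (0 : C(ℝ, ℝ)) (fun J => f (fun p => c q (J p)) / (2 * n + 1)) (M / (2 * n + 1))
      (by positivity) (by
        intro J x _
        simp only [ContinuousMap.zero_apply, sub_zero, abs_div, abs_of_pos hm]
        gcongr
        exact f.norm_coe_le_norm _)
    exact ⟨h, fun t => by simpa using h1 t, fun J => h2 J _ rfl⟩
  choose h hh1 hh2 using hh
  refine ⟨ψ, hψ1, h, fun q t => (hh1 q t).trans ?_, fun x => ?_⟩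
  · apply div_le_self hM.le
    have : (0 : ℝ) ≤ n := by positivity
    linarith
  let bd : Finset (Fin (2 * n + 1)) := Finset.univ.image (fun p => bad (x p))
  have hbd : (bd.card : ℝ) ≤ n := by
    have : bd.card ≤ n := by simpa using Finset.card_image_le (s := Finset.univ) (f := fun p => bad (x p))
    exact_mod_cast this
  have hsum : f x - ∑ q, h q (∑ p, ψ q p (x p)) =
      ∑ q, (f x / (2 * n + 1) - h q (∑ p, ψ q p (x p))) := by
    rw [Finset.sum_sub_distrib]
    simp
    field_simp
  have hterm : ∀ q, |f x / (2 * n + 1) - h q (∑ p, ψ q p (x p))| ≤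
      M / (4 * (2 * n + 1)) / (2 * n + 1) + if q ∈ bd then 2 * M / (2 * n + 1) else 0 := by
    intro q
    split_ifs with hq
    · have h1 := hh1 q (∑ p, ψ q p (x p))
      have h2 : |f x / (2 * n + 1)| ≤ M / (2 * n + 1) := by
        rw [abs_div, abs_of_pos hm]
        gcongr
        exact f.norm_coe_le_norm _
      have h3 := abs_sub (f x / (2 * n + 1)) (h q (∑ p, ψ q p (x p)))
      have h4 : 0 ≤ M / (4 * (2 * n + 1)) / (2 * n + 1) := by positivity
      have h5 : 2 * M / (2 * n + 1) = M / (2 * n + 1) + M / (2 * n + 1) := by ring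
      linarith
    · have hJ : ∀ p, ∃ j, x p ∈ C q j := fun p => hC4 _ _ (fun h => hq (by
        simp only [bd, Finset.mem_image]
        exact ⟨p, Finset.mem_univ _, h.symm⟩))
      choose J hJ using hJ
      have h1 : ∑ p, ψ q p (x p) = ∑ p, v q p (J p) :=
        Finset.sum_congr rfl (fun p _ => hψ2 q p _ _ (hJ p))
      rw [h1, hh2, ← sub_div, abs_div, abs_of_pos hm, add_zero]
      gcongr
      have h2 : dist x (fun p => c q (J p)) < δ₁ := by
        rw [dist_pi_lt_iff hδ₁]
        intro p
        rw [dist_comm]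
        exact (hc q _ _ (hJ p)).trans_le (min_le_left _ _)
      have := hfδ h2
      rw [Real.dist_eq] at this
      exact this.le
  rw [hsum]
  calc _ ≤ ∑ q, |f x / (2 * n + 1) - h q (∑ p, ψ q p (x p))| := Finset.abs_sum_le_sum_abs _ _
    _ ≤ ∑ q : Fin (2 * n + 1), (M / (4 * (2 * n + 1)) / (2 * n + 1) +
        if q ∈ bd then 2 * M / (2 * n + 1) else 0) := Finset.sum_le_sum (fun q _ => hterm q)
    _ = M / (4 * (2 * n + 1)) + bd.card * (2 * M / (2 * n + 1)) := by
      rw [Finset.sum_add_distrib]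
      simp
      field_simp
    _ ≤ M / (4 * (2 * n + 1)) + n * (2 * M / (2 * n + 1)) := by gcongr
    _ < _ := by
      have : (1 - 1 / (2 * (2 * n + 1))) * M - (M / (4 * (2 * n + 1)) + n * (2 * M / (2 * n + 1)))
        = M / (4 * (2 * n + 1)) := by
        field_simp
        ring
      have h2 : 0 < M / (4 * (2 * n + 1)) := by positivity
      linarith

/-- inner sum as a continuous map -/
noncomputable def inner {n : ℕ} (φ : Fin n → C(I, ℝ)) : C(Fin n → I, ℝ) :=
  ∑ p, (φ p).comp ⟨fun x => x p, continuous_apply p⟩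

lemma inner_apply {n : ℕ} (φ : Fin n → C(I, ℝ)) (x) : inner φ x = ∑ p, φ p (x p) := by
  simp [inner]

lemma continuous_inner {n : ℕ} : Continuous (inner (n := n)) := by
  unfold inner
  refine continuous_finsetSum _ (fun p _ => ?_)
  exact (ContinuousMap.continuous_precomp _).comp (continuous_apply p)

def U {n : ℕ} (f : C(Fin n → I, ℝ)) : Set (Fin (2 * n + 1) → Fin n → C(I, ℝ)) :=
  {φ | f = 0 ∨ ∃ h : Fin (2 * n + 1) → C(ℝ, ℝ), (∀ q t, |h q t| ≤ ‖f‖) ∧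
    ‖f - ∑ q, (h q).comp (inner (φ q))‖ < (1 - 1 / (2 * (2 * n + 1))) * ‖f‖}

lemma isOpen_U {n : ℕ} (f : C(Fin n → I, ℝ)) : IsOpen (U f) := by
  have : U f = {φ | f = 0} ∪ ⋃ h ∈ {h : Fin (2 * n + 1) → C(ℝ, ℝ) | ∀ q t, |h q t| ≤ ‖f‖},
      {φ | ‖f - ∑ q, (h q).comp (inner (φ q))‖ < (1 - 1 / (2 * (2 * n + 1))) * ‖f‖} := by
    ext φ
    simp [U]
  rw [this]
  refine isOpen_const.union (isOpen_biUnion (fun h _ => ?_))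
  refine isOpen_lt (continuous_norm.comp (continuous_const.sub ?_)) continuous_const
  refine continuous_finsetSum _ (fun q _ => ?_)
  exact (ContinuousMap.continuous_postcomp (h q)).comp (continuous_inner.comp (continuous_apply q))

lemma dense_U {n : ℕ} (f : C(Fin n → I, ℝ)) : Dense (U f) := by
  by_cases hf : f = 0
  · have : U f = Set.univ := by ext φ; simp [U, hf]
    rw [this]; exact dense_univ
  rw [Metric.dense_iff]
  intro φ r hr
  obtain ⟨ψ, h1, h, h2, h3⟩ := approx n f hf φ (r / 4) (by positivity)
  refine ⟨ψ, ?_, Or.inr ⟨h, h2, ?_⟩⟩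
  · rw [Metric.mem_ball]
    refine lt_of_le_of_lt (b := r / 2) ?_ (by linarith)
    refine (dist_pi_le_iff (by positivity)).2 (fun q => (dist_pi_le_iff (by positivity)).2
      (fun p => (ContinuousMap.dist_le (by positivity)).2 (fun x => ?_)))
    rw [Real.dist_eq]
    linarith [h1 q p x]
  · have hM : 0 < ‖f‖ := norm_pos_iff.2 hf
    have hm : (0 : ℝ) < 1 - 1 / (2 * (2 * n + 1)) := by
      have : (0 : ℝ) ≤ n := by positivity
      rw [sub_pos, div_lt_one (by positivity)]
      linarith
    rw [ContinuousMap.norm_lt_iff _ (mul_pos hm hM)]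
    intro x
    simpa [inner_apply] using h3 x

lemma exists_good (n : ℕ) : ∃ φ : Fin (2 * n + 1) → Fin n → C(I, ℝ), ∃ θ : ℝ, 0 ≤ θ ∧ θ < 1 ∧
    ∀ f : C(Fin n → I, ℝ), ∃ h : Fin (2 * n + 1) → C(ℝ, ℝ), (∀ q t, |h q t| ≤ 2 * ‖f‖) ∧
      ‖f - ∑ q, (h q).comp (inner (φ q))‖ ≤ θ * ‖f‖ := by
  have : BaireSpace (Fin (2 * n + 1) → Fin n → C(I, ℝ)) :=
    BaireSpace.of_completelyPseudoMetrizable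
  have hd : Dense (⋂ k : ℕ, U (TopologicalSpace.denseSeq C(Fin n → I, ℝ) k)) :=
    dense_iInter_of_isOpen (fun k => isOpen_U _) (fun k => dense_U _)
  obtain ⟨φ, hφ⟩ := hd.nonempty
  rw [Set.mem_iInter] at hφ
  set η : ℝ := 1 / (8 * (2 * n + 1)) with hη
  have hη0 : 0 < η := by positivity
  have hη1 : η ≤ 1 / 8 := by
    rw [hη]
    apply one_div_le_one_div_of_le (by norm_num)
    have : (0 : ℝ) ≤ n := by positivity
    linarith
  have hη4 : (1 : ℝ) / (2 * (2 * n + 1)) = 4 * η := by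
    rw [hη]; field_simp; norm_num
  refine ⟨φ, 1 - 2 * η, by linarith, by linarith, fun f => ?_⟩
  by_cases hf : f = 0
  · refine ⟨0, by simp [hf], ?_⟩
    have : ∑ q : Fin (2 * n + 1), ((0 : Fin (2 * n + 1) → C(ℝ, ℝ)) q).comp (inner (φ q)) = 0 :=
      Finset.sum_eq_zero (fun q _ => by ext; simp)
    rw [this, hf]; simp
  have hM : 0 < ‖f‖ := norm_pos_iff.2 hf
  obtain ⟨k, hk⟩ := (TopologicalSpace.denseRange_denseSeq C(Fin n → I, ℝ)).exists_dist_lt f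
    (mul_pos hη0 hM)
  have hφk := hφ k
  generalize TopologicalSpace.denseSeq C(Fin n → I, ℝ) k = g at hk hφk
  rw [dist_eq_norm] at hk
  have hg1 : ‖g‖ ≤ ‖f‖ + η * ‖f‖ := by
    have := norm_sub_norm_le g f
    rw [norm_sub_rev] at this
    linarith
  rcases hφk with h0 | ⟨h, h1, h2⟩
  · rw [h0, sub_zero] at hk
    nlinarith
  refine ⟨h, fun q t => (h1 q t).trans (by nlinarith), ?_⟩
  have h3 : f - ∑ q, (h q).comp (inner (φ q)) =
    (f - g) + (g - ∑ q, (h q).comp (inner (φ q))) := by abel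
  rw [h3]
  refine (norm_add_le _ _).trans ?_
  rw [hη4] at h2
  have : (1 - 4 * η) * ‖g‖ ≤ (1 - 4 * η) * (‖f‖ + η * ‖f‖) :=
    mul_le_mul_of_nonneg_left hg1 (by linarith)
  have h5 : 0 ≤ η * η * ‖f‖ := by positivity
  nlinarith

lemma exists_outer (n : ℕ) : ∃ φ : Fin (2 * n + 1) → Fin n → C(I, ℝ),
    ∀ f : C(Fin n → I, ℝ), ∃ h : Fin (2 * n + 1) → C(ℝ, ℝ),
      ∀ x, f x = ∑ q, h q (∑ p, φ q p (x p)) := by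
  obtain ⟨φ, θ, hθ0, hθ1, H⟩ := exists_good n
  choose h h1 h2 using H
  refine ⟨φ, fun f => ?_⟩
  let r : ℕ → C(Fin n → I, ℝ) := fun k =>
    Nat.rec f (fun _ g => g - ∑ q, (h g q).comp (inner (φ q))) k
  have hr0 : r 0 = f := rfl
  have hrs : ∀ k, r (k + 1) = r k - ∑ q, (h (r k) q).comp (inner (φ q)) := fun k => rfl
  have hrn : ∀ k, ‖r k‖ ≤ ‖f‖ * θ ^ k := by
    intro k
    induction k with
    | zero => simp [hr0]
    | succ k ih =>
      rw [hrs, pow_succ]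
      have := h2 (r k)
      nlinarith
  have hgeo : Summable (fun k => 2 * (‖f‖ * θ ^ k)) :=
    ((summable_geometric_of_lt_one hθ0 hθ1).mul_left _).mul_left _
  have hb : ∀ q k t, ‖h (r k) q t‖ ≤ 2 * (‖f‖ * θ ^ k) := fun q k t =>
    (h1 (r k) q t).trans (by linarith [hrn k])
  refine ⟨fun q => ⟨fun t => ∑' k, h (r k) q t,
    continuous_tsum (fun k => (h (r k) q).continuous) hgeo (hb q)⟩, fun x => ?_⟩
  have hs : ∀ q, HasSum (fun k => h (r k) q (∑ p, φ q p (x p)))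
      (∑' k, h (r k) q (∑ p, φ q p (x p))) := fun q =>
    (Summable.of_norm_bounded hgeo (fun k => hb q k _)).hasSum
  have hS := hasSum_sum (s := Finset.univ) (fun q _ => hs q)
  have hpart : ∀ N, ∑ k ∈ Finset.range N, ∑ q, h (r k) q (∑ p, φ q p (x p)) = f x - r N x := by
    intro N
    induction N with
    | zero => simp [hr0]
    | succ N ih =>
      rw [Finset.sum_range_succ, ih, hrs]
      simp [inner_apply]
      ring
  have hlim : Filter.Tendsto (fun N => f x - r N x) Filter.atTop (nhds (f x - 0)) := by
    refine tendsto_const_nhds.sub (squeeze_zero_norm (a := fun N => ‖f‖ * θ ^ N)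
      (fun N => ((r N).norm_coe_le_norm x).trans (hrn N)) ?_)
    simpa using (tendsto_pow_atTop_nhds_zero_of_lt_one hθ0 hθ1).const_mul ‖f‖
  have hT := hS.tendsto_sum_nat
  simp only [hpart] at hT
  have := tendsto_nhds_unique hlim hT
  simpa using this

end KA



/-- **Kolmogorov–Arnold representation theorem.**
For every `n ≥ 1` and every continuous `f : [0,1]^n → ℝ` there are continuous
outer functions `Φ q : ℝ → ℝ` (for `q = 1, …, 2n+1`) and continuous inner
functions `φ q p : [0,1] → ℝ` (for `q = 1, …, 2n+1`, `p = 1, …, n`) with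
`f x = ∑_{q} Φ q (∑_{p} φ q p (x p))` for all `x ∈ [0,1]^n`. -/
theorem kolmogorov_arnold_representation
    (n : ℕ) (hn : 1 ≤ n)
    (f : (Fin n → Set.Icc (0 : ℝ) 1) → ℝ) (hf : Continuous f) :
    ∃ (Φ : Fin (2 * n + 1) → ℝ → ℝ) (φ : Fin (2 * n + 1) → Fin n → Set.Icc (0 : ℝ) 1 → ℝ),
      (∀ q, Continuous (Φ q)) ∧
      (∀ q p, Continuous (φ q p)) ∧
      ∀ x : Fin n → Set.Icc (0 : ℝ) 1,
        f x = ∑ q : Fin (2 * n + 1), Φ q (∑ p : Fin n, φ q p (x p)) := by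
  obtain ⟨φ, H⟩ := KA.exists_outer n
  obtain ⟨h, hh⟩ := H ⟨f, hf⟩
  exact ⟨fun q => h q, fun q p => φ q p, fun q => (h q).continuous,
    fun q p => (φ q p).continuous, hh⟩
end

section
/- KAN approximation bound (Theorem 1 of Liu et al.): let k ≥ 1 and let f : [0,1]^{n_0} → ℝ admit a KAN representation f = Φ_{L−1} ∘ Φ_{L−2} ∘ ⋯ ∘ Φ_0 with layer widths n_0, n_1, …, n_L, n_L = 1, where each layer map Φ_l : ℝ^{n_l} → ℝ^{n_{l+1}} has components (Φ_l(x))_j = Σ_{i=1}^{n_l} φ_{l,j,i}(x_i) and each φ_{l,j,i} : ℝ → ℝ is (k+1)-times continuously differentiable. Then there exists a constant C > 0, depending on f and on this representation, such that for every integer G ≥ 1 there exist functions φ^G_{l,j,i}, each of which is a spline of degree k on a uniform grid with G subintervals of a bounded interval containing the range of the corresponding intermediate coordinate (i.e., (k−1)-times continuously differentiable and agreeing with a polynomial of degree ≤ k on each grid subinterval), such that for every integer m with 0 ≤ m ≤ k, the C^m norm of f − (Φ^G_{L−1} ∘ ⋯ ∘ Φ^G_0) over [0,1]^{n_0} is at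 most C · G^{−k−1+m}, where Φ^G_l is the layer map built from the φ^G_{l,j,i} in the same way. -/
open Set

/-- The map of one KAN layer built from the univariate functions `φ j i`:
the `j`-th output coordinate is `∑ i, φ j i (x i)`. -/
noncomputable def kanLayer {nin nout : ℕ} (φ : Fin nout → Fin nin → ℝ → ℝ) :
    (Fin nin → ℝ) → (Fin nout → ℝ) :=
  fun x j => ∑ i : Fin nin, φ j i (x i)

/-- The composition `Φ_{L-1} ∘ ⋯ ∘ Φ_0` of the first `L` KAN layers, where layer
`l` maps `ℝ^{n l}` to `ℝ^{n (l+1)}` and is built from the functions `φ l j i`. -/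
noncomputable def kanComp (n : ℕ → ℕ) (φ : (l : ℕ) → Fin (n (l + 1)) → Fin (n l) → ℝ → ℝ) :
    (L : ℕ) → (Fin (n 0) → ℝ) → (Fin (n L) → ℝ)
  | 0 => id
  | (L + 1) => fun x => kanLayer (φ L) (kanComp n φ L x)

/-- `s` is a spline of degree `k` on the uniform grid with `G` subintervals of `[a, b]`:
it is `(k-1)`-times continuously differentiable on `[a, b]` and agrees with a polynomial
of degree at most `k` on each grid subinterval. -/
def IsUniformSplineOn (s : ℝ → ℝ) (k G : ℕ) (a b : ℝ) : Prop :=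
  ContDiffOn ℝ (k - 1 : ℕ) s (Icc a b) ∧
    ∀ j : ℕ, j < G → ∃ P : Polynomial ℝ, P.degree ≤ (k : ℕ) ∧
      ∀ x ∈ Icc (a + j * (b - a) / G) (a + (j + 1) * (b - a) / G), s x = P.eval x

/-- Scaled `C^{d,1}` bound: `‖D^m e‖ ≤ ε η^m` for `m ≤ d` and `D^d e` is `ε η^(d+1)`-Lipschitz. -/
def WB {E : Type} [NormedAddCommGroup E] [NormedSpace ℝ E] :
    ℕ → ∀ (V : Type) [NormedAddCommGroup V] [NormedSpace ℝ V], ℝ → ℝ → (E → V) → Prop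
  | 0, _, _, _, ε, η, e => (∀ x, ‖e x‖ ≤ ε) ∧ ∀ x y, ‖e x - e y‖ ≤ ε * η * ‖x - y‖
  | d + 1, V, _, _, ε, η, e => (∀ x, ‖e x‖ ≤ ε) ∧ Differentiable ℝ e ∧
      WB d (E →L[ℝ] V) (ε * η) η (fderiv ℝ e)

section WBcalc

variable {E : Type} [NormedAddCommGroup E] [NormedSpace ℝ E]

theorem WB.bd {d : ℕ} {V : Type} [NormedAddCommGroup V] [NormedSpace ℝ V] {ε η : ℝ} {e : E → V}
    (h : WB d V ε η e) (x : E) : ‖e x‖ ≤ ε := by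
  cases d with
  | zero => exact h.1 x
  | succ d => exact h.1 x

theorem WB.nonneg {d : ℕ} {V : Type} [NormedAddCommGroup V] [NormedSpace ℝ V] {ε η : ℝ} {e : E → V}
    (h : WB d V ε η e) : 0 ≤ ε := (norm_nonneg _).trans (h.bd 0)

theorem WB.mono {d : ℕ} {V : Type} [NormedAddCommGroup V] [NormedSpace ℝ V] {ε η ε' η' : ℝ}
    {e : E → V} (h : WB d V ε η e) (hε : ε ≤ ε') (hη0 : 0 ≤ η) (hη : η ≤ η') :
    WB d V ε' η' e := by
  induction d generalizing V ε ε' with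
  | zero =>
    have h0 := h.nonneg
    refine ⟨fun x => (h.1 x).trans hε, fun x y => (h.2 x y).trans ?_⟩
    gcongr
    exact h0.trans hε
  | succ d ih =>
    have h0 := h.nonneg
    refine ⟨fun x => (h.1 x).trans hε, h.2.1, ih h.2.2 ?_⟩
    have := h0.trans hε
    gcongr

theorem WB.lip {d : ℕ} {V : Type} [NormedAddCommGroup V] [NormedSpace ℝ V] {ε η : ℝ} {e : E → V}
    (h : WB d V ε η e) (x y : E) : ‖e x - e y‖ ≤ ε * η * ‖x - y‖ := by
  cases d with
  | zero => exact h.2 x y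
  | succ d =>
    exact Convex.norm_image_sub_le_of_norm_fderiv_le (𝕜 := ℝ) (s := univ)
      (fun z _ => h.2.1 z) (fun z _ => h.2.2.bd z) convex_univ (mem_univ _) (mem_univ _)

theorem WB.pred {d : ℕ} {V : Type} [NormedAddCommGroup V] [NormedSpace ℝ V] {ε η : ℝ} {e : E → V}
    (h : WB (d + 1) V ε η e) : WB d V ε η e := by
  induction d generalizing V ε with
  | zero => exact ⟨h.bd, h.lip⟩
  | succ d ih => exact ⟨h.1, h.2.1, ih h.2.2⟩

theorem WB.add {d : ℕ} {V : Type} [NormedAddCommGroup V] [NormedSpace ℝ V] {ε₁ ε₂ η : ℝ}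
    {u v : E → V} (hu : WB d V ε₁ η u) (hv : WB d V ε₂ η v) :
    WB d V (ε₁ + ε₂) η (fun x => u x + v x) := by
  induction d generalizing V ε₁ ε₂ with
  | zero =>
    refine ⟨fun x => (norm_add_le _ _).trans (add_le_add (hu.1 x) (hv.1 x)), fun x y => ?_⟩
    have : u x + v x - (u y + v y) = (u x - u y) + (v x - v y) := by abel
    rw [this]
    have h1 := hu.2 x y
    have h2 := hv.2 x y
    have := norm_add_le (u x - u y) (v x - v y)
    linarith
  | succ d ih =>
    refine ⟨fun x => (norm_add_le _ _).trans (add_le_add (hu.1 x) (hv.1 x)),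
      hu.2.1.add hv.2.1, ?_⟩
    have := ih hu.2.2 hv.2.2
    rw [← add_mul] at this
    convert this using 1
    funext x
    exact fderiv_add (hu.2.1 x) (hv.2.1 x)

theorem WB.zero {d : ℕ} {V : Type} [NormedAddCommGroup V] [NormedSpace ℝ V] {ε η : ℝ}
    (hε : 0 ≤ ε) (hη : 0 ≤ η) : WB d V ε η (fun _ : E => (0 : V)) := by
  induction d generalizing V ε with
  | zero => exact ⟨fun x => by simpa using hε, fun x y => by simp; positivity⟩
  | succ d ih =>
    refine ⟨fun x => by simpa using hε, differentiable_const _, ?_⟩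
    have := ih (V := E →L[ℝ] V) (mul_nonneg hε hη)
    convert this using 1
    funext x
    simp

theorem WB.sum {d : ℕ} {V : Type} [NormedAddCommGroup V] [NormedSpace ℝ V] {η : ℝ} (hη : 0 ≤ η)
    {ι : Type} (s : Finset ι) {ε : ι → ℝ} {u : ι → E → V} (h : ∀ i ∈ s, WB d V (ε i) η (u i)) :
    WB d V (∑ i ∈ s, ε i) η (fun x => ∑ i ∈ s, u i x) := by
  classical
  induction s using Finset.induction_on with
  | empty => simpa using WB.zero le_rfl hη
  | insert a s ha ih =>
    simp only [Finset.sum_insert ha]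
    exact (h a (by simp)).add (ih fun i hi => h i (by simp [hi]))

theorem WB.clm {d : ℕ} {V V' : Type} [NormedAddCommGroup V] [NormedSpace ℝ V]
    [NormedAddCommGroup V'] [NormedSpace ℝ V'] {ε η : ℝ} (hη : 0 ≤ η)
    {u : E → V} (hu : WB d V ε η u) (T : V →L[ℝ] V') :
    WB d V' (‖T‖ * ε) η (fun x => T (u x)) := by
  induction d generalizing V V' ε with
  | zero =>
    refine ⟨fun x => T.le_opNorm_of_le (hu.1 x), fun x y => ?_⟩
    rw [← map_sub, mul_assoc, mul_assoc, ← mul_assoc ε]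
    exact T.le_opNorm_of_le (hu.2 x y)
  | succ d ih =>
    refine ⟨fun x => T.le_opNorm_of_le (hu.1 x), T.differentiable.comp hu.2.1, ?_⟩
    have := ih hu.2.2 (ContinuousLinearMap.compL ℝ E V V' T)
    have h0 := hu.2.2.nonneg
    have hT : ‖ContinuousLinearMap.compL ℝ E V V' T‖ ≤ ‖T‖ := by
      refine ContinuousLinearMap.opNorm_le_bound _ (norm_nonneg T) fun A => ?_
      exact ContinuousLinearMap.opNorm_comp_le T A
    have h2 : ‖ContinuousLinearMap.compL ℝ E V V' T‖ * (ε * η) ≤ ‖T‖ * ε * η := by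
      rw [mul_assoc]; gcongr
    convert this.mono h2 hη le_rfl using 1
    funext x
    exact ((T.hasFDerivAt).comp x (hu.2.1 x).hasFDerivAt).fderiv

theorem WB.neg {d : ℕ} {V : Type} [NormedAddCommGroup V] [NormedSpace ℝ V] {ε η : ℝ}
    {u : E → V} (hu : WB d V ε η u) :
    WB d V ε η (fun x => - u x) := by
  induction d generalizing V ε with
  | zero =>
    refine ⟨fun x => by simpa using hu.1 x, fun x y => ?_⟩
    have := hu.2 x y
    rwa [← norm_neg, neg_sub_neg, neg_sub]
  | succ d ih =>
    refine ⟨fun x => by simpa using hu.1 x, hu.2.1.neg, ?_⟩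
    convert ih hu.2.2 using 1
    funext x
    simp

theorem WB.sub {d : ℕ} {V : Type} [NormedAddCommGroup V] [NormedSpace ℝ V] {ε₁ ε₂ η : ℝ}
    {u v : E → V} (hu : WB d V ε₁ η u) (hv : WB d V ε₂ η v) :
    WB d V (ε₁ + ε₂) η (fun x => u x - v x) := by
  simpa [sub_eq_add_neg] using hu.add hv.neg

theorem WB.bilin {d : ℕ} {V₁ V₂ V₃ : Type} [NormedAddCommGroup V₁] [NormedSpace ℝ V₁]
    [NormedAddCommGroup V₂] [NormedSpace ℝ V₂] [NormedAddCommGroup V₃] [NormedSpace ℝ V₃]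
    {ε₁ ε₂ η : ℝ} (hη : 0 ≤ η) {u : E → V₁} {v : E → V₂}
    (hu : WB d V₁ ε₁ η u) (hv : WB d V₂ ε₂ η v) (B : V₁ →L[ℝ] V₂ →L[ℝ] V₃) {K : ℝ} (hB : ‖B‖ ≤ K) :
    WB d V₃ (2 ^ (d + 1) * K * ε₁ * ε₂) η (fun x => B (u x) (v x)) := by
  have hK : 0 ≤ K := (norm_nonneg B).trans hB
  induction d generalizing V₁ V₂ V₃ ε₁ ε₂ with
  | zero =>
    have h1 := hu.nonneg
    have h2 := hv.nonneg
    have key : ∀ a b (p q : ℝ), ‖a‖ ≤ p → ‖b‖ ≤ q → ‖B a b‖ ≤ K * p * q := by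
      intro a b p q hp hq
      refine (B.le_opNorm₂ a b).trans ?_
      have := (norm_nonneg a).trans hp
      gcongr
    refine ⟨fun x => (key _ _ _ _ (hu.1 x) (hv.1 x)).trans ?_, fun x y => ?_⟩
    · have : 0 ≤ K * ε₁ * ε₂ := by positivity
      norm_num; nlinarith
    · have e1 : B (u x) (v x) - B (u y) (v y) = B (u x - u y) (v x) + B (u y) (v x - v y) := by
        simp
      rw [e1]
      have a1 := key _ _ _ _ (hu.2 x y) (hv.1 x)
      have a2 := key _ _ _ _ (hu.1 y) (hv.2 x y)
      refine (norm_add_le _ _).trans ((add_le_add a1 a2).trans (le_of_eq ?_))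
      ring
  | succ d ih =>
    have h1 := hu.nonneg
    have h2 := hv.nonneg
    refine ⟨fun x => ?_, ?_, ?_⟩
    · have h3 : ‖B (u x) (v x)‖ ≤ K * ε₁ * ε₂ := by
        refine (B.le_opNorm₂ _ _).trans ?_
        have := hu.1 x
        have := hv.1 x
        gcongr
      refine h3.trans ?_
      have : 0 ≤ K * ε₁ * ε₂ := by positivity
      have h4 : (1 : ℝ) ≤ 2 ^ (d + 1 + 1) := one_le_pow₀ (by norm_num)
      nlinarith
    · intro x
      exact (B.hasFDerivAt_of_bilinear (hu.2.1 x).hasFDerivAt (hv.2.1 x).hasFDerivAt).differentiableAt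
    · have a1 := ih hu.pred hv.2.2 (B.precompR E) ((B.norm_precompR_le E).trans hB)
      have a2 := ih hu.2.2 hv.pred (B.precompL E) ((B.norm_precompL_le E).trans hB)
      have a3 := a1.add a2
      have hle : 2 ^ (d + 1) * K * ε₁ * (ε₂ * η) + 2 ^ (d + 1) * K * (ε₁ * η) * ε₂ ≤
          2 ^ (d + 1 + 1) * K * ε₁ * ε₂ * η := le_of_eq (by ring)
      convert a3.mono hle hη le_rfl using 1
      funext x
      exact (B.hasFDerivAt_of_bilinear (hu.2.1 x).hasFDerivAt (hv.2.1 x).hasFDerivAt).fderiv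

theorem WB.toOne {d : ℕ} {V : Type} [NormedAddCommGroup V] [NormedSpace ℝ V] {ε η : ℝ}
    {u : E → V} (hu : WB d V ε η u) (hη : 1 ≤ η) : WB d V (ε * η ^ (d + 1)) 1 u := by
  induction d generalizing V ε with
  | zero =>
    have := hu.nonneg
    refine ⟨fun x => (hu.1 x).trans ?_, fun x y => (hu.2 x y).trans (by simp)⟩
    simp; nlinarith
  | succ d ih =>
    have := hu.nonneg
    refine ⟨fun x => (hu.1 x).trans (le_mul_of_one_le_right this (one_le_pow₀ hη)), hu.2.1, ?_⟩
    convert ih hu.2.2 using 1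
    ring

/-- composition -/
theorem WB.comp {d : ℕ} (M : ℝ) (hM : 0 ≤ M) {V₁ : Type} [NormedAddCommGroup V₁]
    [NormedSpace ℝ V₁] :
    ∃ C : ℝ, 0 ≤ C ∧ ∀ (V₂ : Type) [NormedAddCommGroup V₂] [NormedSpace ℝ V₂] (ε η : ℝ),
      1 ≤ η → ∀ (g : V₁ → V₂) (F : E → V₁), WB d V₂ ε η g → WB d V₁ M 1 F →
      WB d V₂ (C * ε) η (fun x => g (F x)) := by
  induction d with
  | zero =>
    refine ⟨1 + M, by linarith, ?_⟩
    intro V₂ _ _ ε η hη g F hg hF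
    have h0 := hg.nonneg
    refine ⟨fun x => (hg.1 _).trans (by nlinarith [mul_nonneg hM h0]), fun x y => ?_⟩
    calc _ ≤ ε * η * ‖F x - F y‖ := hg.2 _ _
      _ ≤ ε * η * (M * 1 * ‖x - y‖) := by gcongr; exact hF.2 _ _
      _ ≤ _ := by
        have : 0 ≤ ε * η * ‖x - y‖ := by positivity
        nlinarith
  | succ d ih =>
    obtain ⟨C, hC, H⟩ := ih
    refine ⟨1 + 2 ^ (d + 1) * C * M, by positivity, ?_⟩
    intro V₂ _ _ ε η hη g F hg hF
    have h0 := hg.nonneg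
    have h00 := hg.2.2.nonneg
    refine ⟨fun x => (hg.1 _).trans ?_, hg.2.1.comp hF.2.1, ?_⟩
    · have : 0 ≤ 2 ^ (d + 1) * C * M * ε := by positivity
      linarith
    · have a1 := H _ _ _ hη _ _ hg.2.2 hF.pred
      have a2 := hF.2.2.mono (ε' := M) (η' := η) (by simp) zero_le_one hη
      have a3 := a1.bilin (by linarith) a2 (ContinuousLinearMap.compL ℝ E V₁ V₂)
        (ContinuousLinearMap.norm_compL_le (𝕜 := ℝ) E V₁ V₂)
      have hle : 2 ^ (d + 1) * 1 * (C * (ε * η)) * M ≤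
          (1 + 2 ^ (d + 1) * C * M) * ε * η := by
        linarith
      convert a3.mono hle (by linarith) le_rfl using 1
      funext x
      exact fderiv_fun_comp x (hg.2.1 _) (hF.2.1 x)

theorem WB.comp_sub {d : ℕ} (M : ℝ) (hM : 0 ≤ M) {V₁ : Type} [NormedAddCommGroup V₁]
    [NormedSpace ℝ V₁] :
    ∃ C : ℝ, 0 ≤ C ∧ ∀ (V₂ : Type) [NormedAddCommGroup V₂] [NormedSpace ℝ V₂] (ε η : ℝ),
      1 ≤ η → ∀ (g : V₁ → V₂) (F F' : E → V₁), WB (d + 1) V₂ M 1 g → WB d V₁ M 1 F →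
      WB d V₁ M 1 F' → WB d V₁ ε η (fun x => F x - F' x) →
      WB d V₂ (C * ε) η (fun x => g (F x) - g (F' x)) := by
  induction d with
  | zero =>
    refine ⟨M + 3 * M * M, by positivity, ?_⟩
    intro V₂ _ _ ε η hη g F F' hg hF hF' hd
    have h0 := hd.nonneg
    refine ⟨fun x => ?_, fun x y => ?_⟩
    · calc _ ≤ M * 1 * ‖F x - F' x‖ := hg.lip _ _
        _ ≤ M * 1 * ε := by gcongr; exact hd.1 x
        _ ≤ _ := by nlinarith [mul_nonneg (mul_nonneg hM hM) h0]
    · set p := F x - F' x with hp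
      set q := F y - F' y with hq
      have hder : ∀ t ∈ Icc (0 : ℝ) 1, HasDerivWithinAt
          (fun t : ℝ => g (F' x + t • p) - g (F' y + t • q))
          (fderiv ℝ g (F' x + t • p) p - fderiv ℝ g (F' y + t • q) q) (Icc 0 1) t := by
        intro t _
        have k1 : ∀ a b : V₁, HasDerivAt (fun t : ℝ => g (a + t • b))
            (fderiv ℝ g (a + t • b) b) t := by
          intro a b
          have l1 : HasDerivAt (fun t : ℝ => a + t • b) b t := by
            simpa using ((hasDerivAt_id t).smul_const b).const_add a
          exact (hg.2.1 _).hasFDerivAt.comp_hasDerivAt t l1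
        exact ((k1 _ _).sub (k1 _ _)).hasDerivWithinAt
      have hbd : ∀ t ∈ Ico (0 : ℝ) 1,
          ‖fderiv ℝ g (F' x + t • p) p - fderiv ℝ g (F' y + t • q) q‖ ≤
            3 * M * M * ε * ‖x - y‖ + M * (ε * η * ‖x - y‖) := by
        intro t ht
        have e1 : fderiv ℝ g (F' x + t • p) p - fderiv ℝ g (F' y + t • q) q =
          (fderiv ℝ g (F' x + t • p) - fderiv ℝ g (F' y + t • q)) p +
            fderiv ℝ g (F' y + t • q) (p - q) := by simp
        rw [e1]
        have b1 : ‖(F' x + t • p) - (F' y + t • q)‖ ≤ 3 * M * ‖x - y‖ := by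
          have : (F' x + t • p) - (F' y + t • q) =
              (1 - t) • (F' x - F' y) + t • (F x - F y) := by
            rw [hp, hq]; module
          rw [this]
          have c1 := hF.2 x y
          have c2 := hF'.2 x y
          rw [mul_one] at c1 c2
          refine (norm_add_le _ _).trans ?_
          rw [norm_smul, norm_smul, Real.norm_of_nonneg ht.1,
            Real.norm_of_nonneg (by linarith [ht.2])]
          have := ht.2
          have := ht.1
          have : 0 ≤ M * ‖x - y‖ := by positivity
          nlinarith [norm_nonneg (F' x - F' y), norm_nonneg (F x - F y)]
        have b2 := hg.2.2.2 (F' x + t • p) (F' y + t • q)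
        have b3 : ‖fderiv ℝ g (F' x + t • p) - fderiv ℝ g (F' y + t • q)‖ ≤
            3 * M * M * ‖x - y‖ := by
          refine b2.trans ?_
          have := mul_le_mul_of_nonneg_left b1 hM
          linarith
        have b4 := ContinuousLinearMap.le_of_opNorm_le_of_le _ b3 (hd.1 x)
        have b5 : ‖fderiv ℝ g (F' y + t • q)‖ ≤ M := by simpa using hg.2.2.1 (F' y + t • q)
        have b6 := ContinuousLinearMap.le_of_opNorm_le_of_le _ b5 (hd.2 x y)
        refine (norm_add_le _ _).trans ((add_le_add b4 b6).trans (le_of_eq (by ring)))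
      have := norm_image_sub_le_of_norm_deriv_le_segment_01' hder hbd
      have e2 : g (F x) - g (F' x) - (g (F y) - g (F' y)) =
        (g (F' x + (1 : ℝ) • p) - g (F' y + (1 : ℝ) • q)) -
        (g (F' x + (0 : ℝ) • p) - g (F' y + (0 : ℝ) • q)) := by
        rw [hp, hq]; simp; abel
      rw [e2]
      refine this.trans ?_
      have : 0 ≤ 3 * M * M * ε * ‖x - y‖ := by positivity
      nlinarith
  | succ d ih =>
    obtain ⟨C, hC, H⟩ := ih
    obtain ⟨C', hC', H'⟩ := WB.comp (E := E) (V₁ := V₁) (d := d) M hM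
    refine ⟨M + 2 ^ (d + 1) * C * M + 2 ^ (d + 1) * (C' * M), by positivity, ?_⟩
    intro V₂ _ _ ε η hη g F F' hg hF hF' hd
    have hη0 : 0 ≤ η := by linarith
    have h0 := hd.nonneg
    refine ⟨fun x => ?_, (hg.2.1.comp hF.2.1).sub (hg.2.1.comp hF'.2.1), ?_⟩
    · calc _ ≤ M * 1 * ‖F x - F' x‖ := hg.lip _ _
        _ ≤ M * 1 * ε := by gcongr; exact hd.1 x
        _ ≤ _ := by
          have : 0 ≤ (2 ^ (d + 1) * C * M + 2 ^ (d + 1) * (C' * M)) * ε := by positivity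
          linarith
    · have g1 : WB (d + 1) (V₁ →L[ℝ] V₂) M 1 (fderiv ℝ g) := by simpa using hg.2.2
      have F1 : WB d (E →L[ℝ] V₁) M 1 (fderiv ℝ F) := by simpa using hF.2.2
      have a1 := H _ _ _ hη _ _ _ g1 hF.pred hF'.pred hd.pred
      have a2 := a1.bilin hη0 (F1.mono le_rfl zero_le_one hη) (ContinuousLinearMap.compL ℝ E V₁ V₂)
        (ContinuousLinearMap.norm_compL_le (𝕜 := ℝ) E V₁ V₂)
      have a3 := (H' _ _ _ le_rfl _ _ g1.pred hF'.pred).mono le_rfl zero_le_one hη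
      have a4 := a3.bilin hη0 hd.2.2 (ContinuousLinearMap.compL ℝ E V₁ V₂)
        (ContinuousLinearMap.norm_compL_le (𝕜 := ℝ) E V₁ V₂)
      have hle : 2 ^ (d + 1) * 1 * (C * ε) * M +
          2 ^ (d + 1) * 1 * (C' * M) * (ε * η) ≤
          (M + 2 ^ (d + 1) * C * M + 2 ^ (d + 1) * (C' * M)) * ε * η := by
        calc _ ≤ 2 ^ (d + 1) * 1 * (C * ε) * M * η + 2 ^ (d + 1) * 1 * (C' * M) * (ε * η) :=
              add_le_add (le_mul_of_one_le_right (by positivity) hη) le_rfl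
          _ ≤ _ := by
              have : 0 ≤ M * ε * η := by positivity
              linarith
      convert (a2.add a4).mono hle hη0 le_rfl using 1
      funext x
      have q1 : HasFDerivAt (fun x => g (F x) - g (F' x))
          ((fderiv ℝ g (F x)).comp (fderiv ℝ F x) - (fderiv ℝ g (F' x)).comp (fderiv ℝ F' x)) x :=
        ((hg.2.1 _).hasFDerivAt.comp x (hF.2.1 x).hasFDerivAt).sub
          ((hg.2.1 _).hasFDerivAt.comp x (hF'.2.1 x).hasFDerivAt)
      have q2 : fderiv ℝ (fun x => F x - F' x) x = fderiv ℝ F x - fderiv ℝ F' x :=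
        fderiv_sub (hF.2.1 x) (hF'.2.1 x)
      rw [q1.fderiv, q2]
      ext v
      simp

theorem WB.of_compact {d : ℕ} {V : Type} [NormedAddCommGroup V] [NormedSpace ℝ V]
    {f : E → V} (hf : ContDiff ℝ (d + 1 : ℕ) f) (hc : HasCompactSupport f) :
    ∃ M, WB d V M 1 f := by
  induction d generalizing V with
  | zero =>
    obtain ⟨A, hA⟩ := hc.exists_bound_of_continuous hf.continuous
    have h1 : Continuous (fderiv ℝ f) := hf.continuous_fderiv (by simp)
    obtain ⟨B, hB⟩ := (hc.fderiv ℝ).exists_bound_of_continuous h1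
    refine ⟨max A B, fun x => (hA x).trans (le_max_left _ _), fun x y => ?_⟩
    rw [mul_one]
    exact Convex.norm_image_sub_le_of_norm_fderiv_le (𝕜 := ℝ) (s := univ)
      (fun z _ => hf.differentiable (by simp) z)
      (fun z _ => (hB z).trans (le_max_right _ _)) convex_univ (mem_univ _) (mem_univ _)
  | succ d ih =>
    obtain ⟨A, hA⟩ := hc.exists_bound_of_continuous hf.continuous
    have h1 : ContDiff ℝ (d + 1 : ℕ) (fderiv ℝ f) := hf.fderiv_right (by norm_cast)
    obtain ⟨B, hB⟩ := ih h1 (hc.fderiv ℝ)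
    refine ⟨max A B, fun x => (hA x).trans (le_max_left _ _), hf.differentiable (by simp), ?_⟩
    exact hB.mono (by simp) zero_le_one le_rfl

end WBcalc

section OneD

/-- locally integrable on intervals -/
def LI (u : ℝ → ℝ) : Prop := ∀ x y : ℝ, IntervalIntegrable u MeasureTheory.volume x y

/-- `e` is a primitive of its second argument -/
def Prim (e de : ℝ → ℝ) : Prop := ∀ x y : ℝ, e y - e x = ∫ t in x..y, de t

/-- one-dimensional bounds on weak derivatives up to order `d` -/
def WO : ℕ → ℝ → (ℝ → ℝ) → Prop
  | 0, M, e => LI e ∧ ∀ x, |e x| ≤ M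
  | d + 1, M, e => (∀ x, |e x| ≤ M) ∧ ∃ de, WO d M de ∧ Prim e de

/-- splines of degree `d` on the integer grid -/
def SP : ℕ → (ℝ → ℝ) → Prop
  | 0, s => LI s ∧ ∀ j : ℤ, ∃ c, ∀ x ∈ Ico (j : ℝ) (j + 1), s x = c
  | d + 1, s => ∃ s', SP d s' ∧ Prim s s'

theorem Prim.continuous {e e' : ℝ → ℝ} (h : Prim e e') (hi : LI e') : Continuous e := by
  have : e = fun y => e 0 + ∫ t in (0 : ℝ)..y, e' t := by
    funext y; have := h 0 y; linarith
  rw [this]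
  exact continuous_const.add (intervalIntegral.continuous_primitive hi 0)

theorem LI.of_cont {u : ℝ → ℝ} (h : Continuous u) : LI u := fun x y => h.intervalIntegrable x y

theorem Prim.li {e e' : ℝ → ℝ} (h : Prim e e') (hi : LI e') : LI e := LI.of_cont (h.continuous hi)

theorem LI.shift {u : ℝ → ℝ} (h : LI u) (c : ℝ) : LI (fun x => u (x - c)) := fun x y => by
  have := (h (x - c) (y - c)).comp_sub_right c
  simpa using this

theorem Prim.shift {e e' : ℝ → ℝ} (h : Prim e e') (c : ℝ) :
    Prim (fun x => e (x - c)) (fun x => e' (x - c)) := fun x y => by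
  rw [intervalIntegral.integral_comp_sub_right]
  exact h _ _

theorem Prim.comb {e e' u u' : ℝ → ℝ} (h : Prim e e') (hu : Prim u u') (hi : LI e') (hi' : LI u')
    (c : ℝ) : Prim (fun x => e x + c * u x) (fun x => e' x + c * u' x) := fun x y => by
  rw [intervalIntegral.integral_add (hi x y) ((hi' x y).const_mul c),
    intervalIntegral.integral_const_mul, ← h x y, ← hu x y]
  ring

theorem WO.bd {d : ℕ} {M : ℝ} {e : ℝ → ℝ} (h : WO d M e) (x : ℝ) : |e x| ≤ M := by
  cases d with
  | zero => exact h.2 x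
  | succ d => exact h.1 x

theorem WO.li {d : ℕ} {M : ℝ} {e : ℝ → ℝ} (h : WO d M e) : LI e := by
  induction d generalizing e with
  | zero => exact h.1
  | succ d ih =>
    obtain ⟨_, e', h1, h2⟩ := h
    exact h2.li (ih h1)

theorem SP.li {d : ℕ} {e : ℝ → ℝ} (h : SP d e) : LI e := by
  induction d generalizing e with
  | zero => exact h.1
  | succ d ih =>
    obtain ⟨e', h1, h2⟩ := h
    exact h2.li (ih h1)

theorem WO.mono {d : ℕ} {M M' : ℝ} {e : ℝ → ℝ} (h : WO d M e) (hM : M ≤ M') : WO d M' e := by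
  induction d generalizing e with
  | zero => exact ⟨h.1, fun x => (h.2 x).trans hM⟩
  | succ d ih =>
    obtain ⟨h0, e', h1, h2⟩ := h
    exact ⟨fun x => (h0 x).trans hM, e', ih h1, h2⟩

theorem WO.shift {d : ℕ} {M : ℝ} {e : ℝ → ℝ} (h : WO d M e) (c : ℝ) :
    WO d M (fun x => e (x - c)) := by
  induction d generalizing e with
  | zero => exact ⟨h.1.shift c, fun x => h.2 _⟩
  | succ d ih =>
    obtain ⟨h0, e', h1, h2⟩ := h
    exact ⟨fun x => h0 _, _, ih h1, h2.shift c⟩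

theorem SP.shift {d : ℕ} {e : ℝ → ℝ} (h : SP d e) : SP d (fun x => e (x - 1)) := by
  induction d generalizing e with
  | zero =>
    refine ⟨h.1.shift 1, fun j => ?_⟩
    obtain ⟨c, hc⟩ := h.2 (j - 1)
    refine ⟨c, fun x hx => hc _ ⟨?_, ?_⟩⟩
    · push_cast; linarith [hx.1]
    · push_cast; linarith [hx.2]
  | succ d ih =>
    obtain ⟨e', h1, h2⟩ := h
    exact ⟨_, ih h1, h2.shift 1⟩

theorem LI.comb {e u : ℝ → ℝ} (h : LI e) (hu : LI u) (c : ℝ) : LI (fun x => e x + c * u x) :=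
  fun x y => (h x y).add ((hu x y).const_mul c)

theorem SP.comb {d : ℕ} {e u : ℝ → ℝ} (h : SP d e) (hu : SP d u) (c : ℝ) :
    SP d (fun x => e x + c * u x) := by
  induction d generalizing e u with
  | zero =>
    refine ⟨h.1.comb hu.1 c, fun j => ?_⟩
    obtain ⟨a, ha⟩ := h.2 j
    obtain ⟨b, hb⟩ := hu.2 j
    exact ⟨a + c * b, fun x hx => by simp only [ha x hx, hb x hx]⟩
  | succ d ih =>
    obtain ⟨e', h1, h2⟩ := h
    obtain ⟨u', h1', h2'⟩ := hu
    exact ⟨_, ih h1 h1', h2.comb h2' h1.li h1'.li c⟩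

theorem WO.sub {d : ℕ} {M N : ℝ} {e u : ℝ → ℝ} (h : WO d M e) (hu : WO d N u) :
    WO d (M + N) (fun x => e x + (-1) * u x) := by
  have key : ∀ {a b : ℝ}, |a| ≤ M → |b| ≤ N → |a + (-1) * b| ≤ M + N := by
    intro a b ha hb
    rw [abs_le] at *
    constructor <;> linarith
  induction d generalizing e u with
  | zero => exact ⟨h.1.comb hu.1 _, fun x => key (h.2 x) (hu.2 x)⟩
  | succ d ih =>
    obtain ⟨h0, e', h1, h2⟩ := h
    obtain ⟨h0', u', h1', h2'⟩ := hu
    exact ⟨fun x => key (h0 x) (h0' x), _, ih h1 h1', h2.comb h2' h1.li h1'.li _⟩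

noncomputable def Av (u : ℝ → ℝ) (x : ℝ) : ℝ := ∫ t in (x - 1)..x, u t

theorem Av.prim {u : ℝ → ℝ} (h : LI u) : Prim (Av u) (fun x => u x + (-1) * u (x - 1)) := by
  intro x y
  rw [intervalIntegral.integral_add (h x y) (((h.shift 1) x y).const_mul _),
    intervalIntegral.integral_const_mul, intervalIntegral.integral_comp_sub_right]
  unfold Av
  have e1 := intervalIntegral.integral_add_adjacent_intervals (h (x - 1) x) (h x y)
  have e2 := intervalIntegral.integral_add_adjacent_intervals (h (x - 1) (y - 1)) (h (y - 1) y)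
  linarith

theorem Av.abs_le {u : ℝ → ℝ} {x b : ℝ} (hb : ∀ t ∈ Icc (x - 1) x, |u t| ≤ b) : |Av u x| ≤ b := by
  have := intervalIntegral.norm_integral_le_of_norm_le_const (a := x - 1) (b := x) (f := u) (C := b)
    (fun t ht => hb t (by
      rw [uIoc_of_le (by linarith)] at ht; exact ⟨ht.1.le, ht.2⟩))
  simpa [Av] using this

theorem Av.near {u : ℝ → ℝ} (h : LI u) {x a b : ℝ} (hb : ∀ t ∈ Icc (x - 1) x, |u t - a| ≤ b) :
    |Av u x - a| ≤ b := by
  have h1 : Av (fun t => u t - a) x = Av u x - a := by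
    unfold Av
    rw [intervalIntegral.integral_sub (h _ _) (by simp)]
    simp
  rw [← h1]
  exact Av.abs_le hb

theorem SP.av {d : ℕ} {u : ℝ → ℝ} (h : SP d u) : SP (d + 1) (Av u) :=
  ⟨_, h.comb h.shift (-1), Av.prim h.li⟩

theorem WO.nonneg {d : ℕ} {M : ℝ} {u : ℝ → ℝ} (h : WO d M u) : 0 ≤ M :=
  (abs_nonneg _).trans (h.bd 0)

theorem WO.av {d : ℕ} {M : ℝ} {u : ℝ → ℝ} (h : WO d M u) : WO (d + 1) (2 * M) (Av u) := by
  have h0 := h.nonneg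
  refine ⟨fun x => Av.abs_le fun t _ => (h.bd t).trans (by linarith), _, ?_, Av.prim h.li⟩
  rw [two_mul]
  exact h.sub (h.shift 1)

/-- correction lemma -/
theorem correction (d : ℕ) {e : ℝ → ℝ} {M : ℝ} (hM : 0 ≤ M)
    (he : ∀ x y, |e x - e y| ≤ M * |x - y|) :
    ∃ r r' : ℝ → ℝ, Prim r r' ∧ WO d (2 ^ d * M) r' ∧ SP d r' ∧
      ∀ x, |r x - e x| ≤ (d + 2) * M := by
  have hec : Continuous e := by
    have : LipschitzWith M.toNNReal e := LipschitzWith.of_dist_le_mul fun x y => by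
      rw [Real.dist_eq, Real.dist_eq, Real.coe_toNNReal M hM]; exact he x y
    exact this.continuous
  induction d with
  | zero =>
    set p : ℝ → ℝ := fun x => e ⌊x⌋ with hp
    have hpe : ∀ x, |p x - e x| ≤ M := fun x => by
      have h1 := he ⌊x⌋ x
      have h2 : |(⌊x⌋ : ℝ) - x| ≤ 1 := by
        rw [abs_sub_comm, abs_of_nonneg (sub_nonneg.2 (Int.floor_le x))]
        linarith [Int.lt_floor_add_one x]
      refine h1.trans ?_
      nlinarith
    have hpm : Measurable p := hec.measurable.comp
      ((measurable_from_top (f := fun z : ℤ => (z : ℝ))).comp Int.measurable_floor)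
    have hpi : LI p := by
      intro x y
      have h1 : IntervalIntegrable (fun x => p x - e x) MeasureTheory.volume x y := by
        have hc : IntervalIntegrable (fun _ : ℝ => M) MeasureTheory.volume x y := by simp
        refine hc.mono_fun (hpm.sub hec.measurable).aestronglyMeasurable ?_
        refine Filter.Eventually.of_forall fun t => ?_
        simp only [Real.norm_eq_abs, abs_of_nonneg hM]
        exact hpe t
      have := h1.add (hec.intervalIntegrable x y)
      simpa using this
    refine ⟨Av p, _, Av.prim hpi, ⟨hpi.comb (hpi.shift 1) _, fun x => ?_⟩,
      ⟨hpi.comb (hpi.shift 1) _, fun j => ?_⟩, fun x => ?_⟩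
    · have h1 := he ⌊x⌋ ((⌊x⌋ : ℝ) - 1)
      simp only [hp, Int.floor_sub_one, Int.cast_sub, Int.cast_one]
      rw [neg_one_mul, ← sub_eq_add_neg]
      simpa using h1
    · refine ⟨e j + (-1) * e ((j : ℝ) - 1), fun x hx => ?_⟩
      have : ⌊x⌋ = j := Int.floor_eq_iff.2 hx
      simp only [hp, Int.floor_sub_one, Int.cast_sub, Int.cast_one, this]
    · refine Av.near hpi fun t ht => ?_
      have h1 := hpe t
      have h2 := he t x
      have h3 : |t - x| ≤ 1 := by rw [abs_le]; constructor <;> linarith [ht.1, ht.2]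
      have h4 : |p t - e x| ≤ |p t - e t| + |e t - e x| := abs_sub_le _ _ _
      push_cast
      nlinarith
  | succ d ih =>
    obtain ⟨r, r', h1, h2, h3, h4⟩ := ih
    have hr := h1.li h2.li
    refine ⟨Av r, Av r', ?_, ?_, h3.av, fun x => ?_⟩
    · intro x y
      rw [Av.prim hr x y]
      congr 1
      funext t
      have := h1 (t - 1) t
      unfold Av
      linarith
    · rw [pow_succ']
      rw [mul_assoc]
      exact h2.av
    · refine Av.near hr fun t ht => ?_
      have h1 := h4 t
      have h2 := he t x
      have h3 : |t - x| ≤ 1 := by rw [abs_le]; constructor <;> linarith [ht.1, ht.2]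
      have h4 : |r t - e x| ≤ |r t - e t| + |e t - e x| := abs_sub_le _ _ _
      push_cast
      nlinarith

theorem spline_approx (k : ℕ) : ∃ C : ℝ, 0 ≤ C ∧ ∀ (g : ℝ → ℝ) (M : ℝ),
    ContDiff ℝ (k + 1 : ℕ) g → (∀ x, |iteratedDeriv (k + 1) g x| ≤ M) →
    ∃ s, SP k s ∧ WO k (C * M) (fun x => g x + (-1) * s x) := by
  induction k with
  | zero =>
    refine ⟨2, by norm_num, fun g M hg hM => ?_⟩
    have hM0 : 0 ≤ M := (abs_nonneg _).trans (hM 0)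
    have hl : ∀ x y, |g x - g y| ≤ M * |x - y| := fun x y => by
      have := Convex.norm_image_sub_le_of_norm_deriv_le (𝕜 := ℝ) (f := g) (s := univ) (C := M)
        (x := y) (y := x)
        (fun z _ => hg.differentiable (by simp) z) (fun z _ => by
          have := hM z; simpa [iteratedDeriv_one] using this) convex_univ (mem_univ _) (mem_univ _)
      simpa using this
    set p : ℝ → ℝ := fun x => g ⌊x⌋ with hp
    have hpe : ∀ x, |g x - p x| ≤ M := fun x => by
      have h1 := hl x ⌊x⌋
      have h2 : |x - (⌊x⌋ : ℝ)| ≤ 1 := by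
        rw [abs_of_nonneg (sub_nonneg.2 (Int.floor_le x))]
        linarith [Int.lt_floor_add_one x]
      refine h1.trans ?_
      nlinarith
    have hpm : Measurable p := hg.continuous.measurable.comp
      ((measurable_from_top (f := fun z : ℤ => (z : ℝ))).comp Int.measurable_floor)
    have hd : LI (fun x => g x + (-1) * p x) := by
      intro x y
      have hc : IntervalIntegrable (fun _ : ℝ => M) MeasureTheory.volume x y := by simp
      refine hc.mono_fun (hg.continuous.measurable.add
        (hpm.const_mul _)).aestronglyMeasurable ?_
      refine Filter.Eventually.of_forall fun t => ?_
      simp only [Real.norm_eq_abs, abs_of_nonneg hM0]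
      have := hpe t
      rwa [neg_one_mul, ← sub_eq_add_neg]
    refine ⟨p, ⟨?_, fun j => ⟨g j, fun x hx => ?_⟩⟩, hd, fun x => ?_⟩
    · have := (LI.of_cont hg.continuous).comb hd (-1)
      convert this using 2
      ring
    · have : ⌊x⌋ = j := Int.floor_eq_iff.2 hx
      simp only [hp, this]
    · have := hpe x
      beta_reduce
      rw [neg_one_mul, ← sub_eq_add_neg]
      linarith
  | succ k ih =>
    obtain ⟨C, hC, H⟩ := ih
    refine ⟨2 ^ k * C + (k + 2) * C + C, by positivity, fun g M hg hM => ?_⟩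
    have hM0 : 0 ≤ M := (abs_nonneg _).trans (hM 0)
    have hg' : ContDiff ℝ (k + 1 : ℕ) (deriv g) := by
      have : ContDiff ℝ ((k + 1 : ℕ) + 1) g := by exact_mod_cast hg
      exact (contDiff_succ_iff_deriv.1 this).2.2
    obtain ⟨s, hs, hw⟩ := H (deriv g) M hg' (fun x => by
      rw [← iteratedDeriv_succ']; exact hM x)
    have hgp : Prim g (deriv g) := fun x y => by
      rw [intervalIntegral.integral_deriv_eq_sub
        (fun z _ => hg.differentiable (by simp) z) (hg'.continuous.intervalIntegrable _ _)]
    set S : ℝ → ℝ := fun x => ∫ t in (0 : ℝ)..x, s t with hS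
    have hSp : Prim S s := fun x y => by
      have := intervalIntegral.integral_add_adjacent_intervals (hs.li 0 x) (hs.li x y)
      simp only [hS]; linarith
    set e : ℝ → ℝ := fun x => g x + (-1) * S x with he
    have hep : Prim e (fun x => deriv g x + (-1) * s x) :=
      hgp.comb hSp (LI.of_cont hg'.continuous) hs.li (-1)
    have hCM : 0 ≤ C * M := by positivity
    have hel : ∀ x y, |e x - e y| ≤ C * M * |x - y| := fun x y => by
      rw [hep y x]
      exact intervalIntegral.norm_integral_le_of_norm_le_const (f := fun x => deriv g x + (-1) * s x)
        fun t _ => hw.bd t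
    obtain ⟨r, r', h1, h2, h3, h4⟩ := correction k hCM hel
    refine ⟨fun x => S x + 1 * r x, ⟨_, hs.comb h3 1, hSp.comb h1 hs.li h3.li 1⟩, fun x => ?_,
      fun x => (deriv g x + (-1) * s x) + (-1) * r' x, ?_, ?_⟩
    · have := h4 x
      rw [abs_sub_comm] at this
      have e1 : g x + -1 * (S x + 1 * r x) = e x - r x := by simp only [he]; ring
      beta_reduce
      rw [e1]
      refine this.trans ?_
      have : 0 ≤ 2 ^ k * C * M + C * M := by positivity
      linarith
    · refine (hw.sub h2).mono ?_
      have : 0 ≤ (k + 2) * C * M := by positivity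
      linarith
    · have := hep.comb h1 hw.li h3.li (-1)
      convert this using 2
      simp only [he]; ring

end OneD

section OneD2

theorem exists_antideriv (P : Polynomial ℝ) {d : ℕ} (hP : P.degree ≤ (d : ℕ)) :
    ∃ Q : Polynomial ℝ, Q.degree ≤ ((d + 1 : ℕ) : WithBot ℕ) ∧ Polynomial.derivative Q = P := by
  refine ⟨∑ i ∈ Finset.range (d + 1), Polynomial.monomial (i + 1) (P.coeff i / (i + 1)), ?_, ?_⟩
  · refine (Polynomial.degree_sum_le _ _).trans (Finset.sup_le fun i hi => ?_)
    refine (Polynomial.degree_monomial_le _ _).trans ?_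
    have := Finset.mem_range.1 hi
    exact_mod_cast this
  · rw [Polynomial.derivative_sum]
    have hn : P.natDegree < d + 1 := Nat.lt_succ_of_le (Polynomial.natDegree_le_of_degree_le hP)
    conv_rhs => rw [P.as_sum_range' (d + 1) hn]
    refine Finset.sum_congr rfl fun i _ => ?_
    rw [Polynomial.derivative_monomial]
    congr 1
    push_cast
    have : (i : ℝ) + 1 ≠ 0 := by positivity
    field_simp

theorem Prim.hasDerivAt {e e' : ℝ → ℝ} (h : Prim e e') (hc : Continuous e') (x : ℝ) :
    HasDerivAt e (e' x) x := by
  have : e = fun y => e 0 + ∫ t in (0 : ℝ)..y, e' t := by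
    funext y; have := h 0 y; linarith
  rw [this]
  exact (intervalIntegral.integral_hasDerivAt_right (hc.intervalIntegrable _ _)
    hc.stronglyMeasurable.stronglyMeasurableAtFilter hc.continuousAt).const_add _

theorem SP.contDiff {d : ℕ} {s : ℝ → ℝ} (h : SP (d + 1) s) : ContDiff ℝ d s := by
  induction d generalizing s with
  | zero =>
    obtain ⟨s', h1, h2⟩ := h
    exact contDiff_zero.2 (h2.continuous h1.li)
  | succ d ih =>
    obtain ⟨s', h1, h2⟩ := h
    have hs' := ih h1
    have hd := h2.hasDerivAt hs'.continuous
    have : ContDiff ℝ ((d : ℕ) + 1) s := by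
      refine contDiff_succ_iff_deriv.2 ⟨fun x => (hd x).differentiableAt, by simp, ?_⟩
      have : deriv s = s' := funext fun x => (hd x).deriv
      rwa [this]
    exact_mod_cast this

theorem SP.poly_Ico {d : ℕ} {s : ℝ → ℝ} (h : SP d s) (j : ℤ) :
    ∃ P : Polynomial ℝ, P.degree ≤ (d : ℕ) ∧ ∀ x ∈ Ico (j : ℝ) (j + 1), s x = P.eval x := by
  induction d generalizing s with
  | zero =>
    obtain ⟨c, hc⟩ := h.2 j
    exact ⟨Polynomial.C c, Polynomial.degree_C_le, fun x hx => by simpa using hc x hx⟩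
  | succ d ih =>
    obtain ⟨s', h1, h2⟩ := h
    obtain ⟨P, hP, hPs⟩ := ih h1
    obtain ⟨Q, hQ, hQP⟩ := exists_antideriv P hP
    refine ⟨Q + Polynomial.C (s j - Q.eval (j : ℝ)), ?_, fun x hx => ?_⟩
    · refine (Polynomial.degree_add_le _ _).trans (max_le hQ (Polynomial.degree_C_le.trans ?_))
      exact_mod_cast Nat.zero_le _
    · have e1 := h2 j x
      have e2 : ∫ t in (j : ℝ)..x, s' t = ∫ t in (j : ℝ)..x, P.eval t := by
        refine intervalIntegral.integral_congr fun t ht => ?_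
        rw [uIcc_of_le hx.1] at ht
        exact hPs t ⟨ht.1, ht.2.trans_lt hx.2⟩
      have e3 : ∫ t in (j : ℝ)..x, P.eval t = Q.eval x - Q.eval (j : ℝ) := by
        refine intervalIntegral.integral_eq_sub_of_hasDerivAt (f := fun t => Q.eval t)
          (f' := fun t => P.eval t) (fun t _ => ?_)
          (P.continuous.intervalIntegrable _ _)
        rw [← hQP]
        exact Q.hasDerivAt t
      simp
      linarith

theorem SP.poly_Icc {d : ℕ} {s : ℝ → ℝ} (h : SP (d + 1) s) (j : ℤ) :
    ∃ P : Polynomial ℝ, P.degree ≤ ((d + 1 : ℕ) : WithBot ℕ) ∧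
      ∀ x ∈ Icc (j : ℝ) (j + 1), s x = P.eval x := by
  obtain ⟨P, hP, hPs⟩ := h.poly_Ico j
  refine ⟨P, hP, fun x hx => ?_⟩
  have h1 : EqOn s (fun x => P.eval x) (closure (Ico (j : ℝ) (j + 1))) :=
    EqOn.closure hPs h.contDiff.continuous P.continuous
  rw [closure_Ico (by simp)] at h1
  exact h1 hx

theorem SP.uniform {k G : ℕ} (hk : 1 ≤ k) (hG : 1 ≤ G) {s : ℝ → ℝ} (h : SP k s) {a b : ℝ}
    (hab : a < b) : IsUniformSplineOn (fun x => s ((x - a) * (G / (b - a)))) k G a b := by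
  obtain ⟨d, rfl⟩ : ∃ d, k = d + 1 := ⟨k - 1, by omega⟩
  have hG' : (0 : ℝ) < G := by exact_mod_cast hG
  have hba : 0 < b - a := sub_pos.2 hab
  refine ⟨?_, fun j _ => ?_⟩
  · have h1 := h.contDiff
    simp only [Nat.add_sub_cancel]
    exact (h1.comp ((contDiff_id.sub contDiff_const).mul contDiff_const)).contDiffOn
  · obtain ⟨P, hP, hPs⟩ := h.poly_Icc (j : ℤ)
    refine ⟨P.comp ((Polynomial.X - Polynomial.C a) * Polynomial.C (G / (b - a))), ?_,
      fun x hx => ?_⟩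
    · refine Polynomial.degree_le_of_natDegree_le ?_
      refine Polynomial.natDegree_comp_le.trans ?_
      have h1 : P.natDegree ≤ d + 1 := Polynomial.natDegree_le_of_degree_le hP
      have h2 : ((Polynomial.X - Polynomial.C a) * Polynomial.C ((G : ℝ) / (b - a))).natDegree ≤ 1 := by
        refine (Polynomial.natDegree_mul_C_le _ _).trans ?_
        rw [Polynomial.natDegree_X_sub_C]
      nlinarith
    · beta_reduce
      rw [hPs]
      · simp
      · have e1 : (j : ℝ) = (a + j * (b - a) / G - a) * (G / (b - a)) := by
          field_simp; ring
        have e2 : (j : ℝ) + 1 = (a + (j + 1) * (b - a) / G - a) * (G / (b - a)) := by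
          field_simp; ring
        constructor
        · push_cast
          rw [e1]
          gcongr
          exact hx.1
        · push_cast
          rw [e2]
          gcongr
          exact hx.2

theorem WO.toWB {d : ℕ} {M : ℝ} {e : ℝ → ℝ} (h : WO (d + 1) M e) (a : ℝ) {c η : ℝ} (hc : 0 ≤ c)
    (hη : c ≤ η) : WB d ℝ M η (fun x : ℝ => e ((x - a) * c)) := by
  induction d generalizing e with
  | zero =>
    have hM := h.nonneg
    obtain ⟨h0, e', h1, h2⟩ := h
    refine ⟨fun x => h0 _, fun x y => ?_⟩
    rw [h2]
    refine (intervalIntegral.norm_integral_le_of_norm_le_const fun t _ => h1.bd t).trans ?_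
    have : (x - a) * c - (y - a) * c = (x - y) * c := by ring
    rw [this, abs_mul, abs_of_nonneg hc, Real.norm_eq_abs, mul_assoc, mul_comm |x - y|]
    gcongr
  | succ d ih =>
    have hM := h.nonneg
    obtain ⟨h0, e', h1, h2⟩ := h
    have hcont : Continuous e' := by
      obtain ⟨_, e'', k1, k2⟩ := h1
      exact k2.continuous k1.li
    have hd : ∀ x, HasDerivAt (fun x : ℝ => e ((x - a) * c)) (e' ((x - a) * c) * c) x := fun x => by
      have l1 : HasDerivAt (fun x : ℝ => (x - a) * c) c x := by
        simpa using ((hasDerivAt_id x).sub_const a).mul_const c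
      exact (h2.hasDerivAt hcont _).comp x l1
    refine ⟨fun x => h0 _, fun x => (hd x).differentiableAt, ?_⟩
    have key := (ih h1).clm (hc.trans hη)
      (ContinuousLinearMap.smulRightL ℝ ℝ ℝ (c • (1 : ℝ →L[ℝ] ℝ)))
    have hn : ‖ContinuousLinearMap.smulRightL ℝ ℝ ℝ (c • (1 : ℝ →L[ℝ] ℝ))‖ ≤ η := by
      refine ContinuousLinearMap.opNorm_le_bound _ (hc.trans hη) fun y => ?_
      change ‖ContinuousLinearMap.smulRight (c • (1 : ℝ →L[ℝ] ℝ)) y‖ ≤ _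
      rw [ContinuousLinearMap.norm_smulRight_apply, norm_smul, Real.norm_of_nonneg hc]
      simp
      gcongr
    have hle : ‖ContinuousLinearMap.smulRightL ℝ ℝ ℝ (c • (1 : ℝ →L[ℝ] ℝ))‖ * M ≤ M * η := by
      rw [mul_comm]; gcongr
    convert key.mono hle (hc.trans hη) le_rfl using 1
    funext x
    rw [(hd x).hasFDerivAt.fderiv]
    ext
    simp [mul_comm]

end OneD2

section KanFinal

theorem kan_single {d : ℕ} {φ : ℝ → ℝ} (hφ : ContDiff ℝ (d + 1 + 1 : ℕ) φ) {a b : ℝ}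
    (hab : a + 1 ≤ b) :
    ∃ (ψ : ℝ → ℝ) (s : ℕ → ℝ → ℝ) (M C : ℝ), EqOn ψ φ (Icc a b) ∧ WB (d + 1) ℝ M 1 ψ ∧
      ∀ G : ℕ, 1 ≤ G → IsUniformSplineOn (s G) (d + 1) G a b ∧ WB d ℝ M 1 (s G) ∧
        WB d ℝ (C * ((G : ℝ) ^ (d + 2))⁻¹) G (fun x => ψ x - s G x) := by
  let χ : ContDiffBump (0 : ℝ) := ⟨|a| + |b| + 1, |a| + |b| + 2, by positivity, by linarith⟩
  set ψ : ℝ → ℝ := fun x => χ x * φ x with hψdef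
  have hψ : ContDiff ℝ (d + 1 + 1 : ℕ) ψ := χ.contDiff.mul hφ
  have hψc : HasCompactSupport ψ := χ.hasCompactSupport.mul_right
  obtain ⟨M₀, hM₀⟩ := WB.of_compact hψ hψc
  obtain ⟨K, hK⟩ := (hψc.iteratedFDeriv (𝕜 := ℝ) (d + 1 + 1)).exists_bound_of_continuous
    (hψ.continuous_iteratedFDeriv (m := d + 1 + 1) le_rfl)
  have hK0 : 0 ≤ K := (norm_nonneg _).trans (hK 0)
  obtain ⟨C₀, hC₀, H⟩ := spline_approx (d + 1)
  have hba : 0 < b - a := by linarith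
  set C := C₀ * K * (b - a) ^ (d + 2) with hCdef
  have hC : 0 ≤ C := by positivity
  have key : ∀ G : ℕ, ∃ s : ℝ → ℝ, 1 ≤ G → IsUniformSplineOn s (d + 1) G a b ∧
      WB d ℝ (M₀ + C) 1 s ∧ WB d ℝ (C * ((G : ℝ) ^ (d + 2))⁻¹) G (fun x => ψ x - s x) := by
    intro G
    by_cases hG : 1 ≤ G
    swap
    · exact ⟨0, fun h => absurd h hG⟩
    have hG1 : (1 : ℝ) ≤ G := by exact_mod_cast hG
    have hG0 : (0 : ℝ) < G := by linarith
    set h := (b - a) / G with hh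
    have hh0 : 0 < h := by positivity
    obtain ⟨s, hs, hw⟩ := H (fun y => ψ (a + h * y)) (h ^ (d + 2) * K)
      (hψ.comp (contDiff_const.add (contDiff_const.mul contDiff_id))) (fun x => by
        have e1 := iteratedDeriv_comp_const_mul (n := d + 1 + 1) (f := fun z => ψ (a + z))
          (hψ.comp (contDiff_const.add contDiff_id)) h
        rw [e1]
        beta_reduce
        rw [iteratedDeriv_comp_const_add, abs_mul, abs_of_nonneg (by positivity)]
        gcongr
        have := hK (a + h * x)
        rwa [norm_iteratedFDeriv_eq_norm_iteratedDeriv] at this)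
    have hc : (G : ℝ) / (b - a) ≤ G := div_le_self hG0.le (by linarith)
    have w1 := hw.toWB a (c := G / (b - a)) (η := G) (by positivity) hc
    have w2 : WB d ℝ (C * ((G : ℝ) ^ (d + 2))⁻¹) G
        (fun x => ψ x - s ((x - a) * (G / (b - a)))) := by
      convert w1 using 1
      · rw [hCdef, hh, div_pow]; ring
      · funext x
        have : a + h * ((x - a) * (G / (b - a))) = x := by
          rw [hh]; field_simp; ring
        rw [this]; ring
    refine ⟨fun x => s ((x - a) * (G / (b - a))), fun _ => ⟨hs.uniform (by omega) hG (by linarith),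
      ?_, w2⟩⟩
    have w3 := hM₀.pred.sub (w2.toOne hG1)
    have hle : M₀ + C * ((G : ℝ) ^ (d + 2))⁻¹ * (G : ℝ) ^ (d + 1) ≤ M₀ + C := by
      have : ((G : ℝ) ^ (d + 2))⁻¹ * (G : ℝ) ^ (d + 1) ≤ 1 := by
        rw [inv_mul_le_one₀ (by positivity)]
        exact pow_le_pow_right₀ hG1 (by omega)
      rw [mul_assoc]
      nlinarith
    convert w3.mono hle zero_le_one le_rfl using 1
    funext x
    ring
  choose s hs using key
  refine ⟨ψ, s, M₀ + C, C, fun x hx => ?_, hM₀.mono (by linarith) zero_le_one le_rfl, hs⟩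
  have : χ x = 1 := χ.one_of_mem_closedBall (by
    rw [mem_closedBall_zero_iff, Real.norm_eq_abs]
    change |x| ≤ |a| + |b| + 1
    rw [abs_le]
    constructor
    · linarith [hx.1, neg_abs_le a, abs_nonneg b]
    · linarith [hx.2, le_abs_self b, abs_nonneg a])
  simp [hψdef, this]

theorem cube_fderivWithin_le {n : ℕ} {V : Type} [NormedAddCommGroup V] [NormedSpace ℝ V]
    {f : (Fin n → ℝ) → V} {K : ℝ} (hK : 0 ≤ K) (hl : ∀ x y, ‖f x - f y‖ ≤ K * ‖x - y‖)
    {x : Fin n → ℝ} (hx : x ∈ Icc (0 : Fin n → ℝ) 1) :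
    ‖fderivWithin ℝ f (Icc (0 : Fin n → ℝ) 1) x‖ ≤ 4 * K := by
  by_cases hd : DifferentiableWithinAt ℝ f (Icc (0 : Fin n → ℝ) 1) x
  swap
  · rw [fderivWithin_zero_of_not_differentiableWithinAt hd]; simpa using hK
  have hA := hd.hasFDerivWithinAt
  set A := fderivWithin ℝ f (Icc (0 : Fin n → ℝ) 1) x
  have h1 : ∀ y ∈ Icc (0 : Fin n → ℝ) 1, ‖A (y - x)‖ ≤ K * ‖y - x‖ := by
    intro y hy
    have hlim : Filter.Tendsto (fun m : ℕ => (1 : ℝ) / ((m : ℝ) + 1)) Filter.atTop (nhds 0) :=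
      tendsto_one_div_add_atTop_nhds_zero_nat
    have ht := hA.lim (l := Filter.atTop) (c := fun m : ℕ => (m : ℝ) + 1)
      (d := fun m : ℕ => (1 / ((m : ℝ) + 1)) • (y - x)) (v := y - x)
      (by simpa using hlim.smul_const (y - x))
      (Filter.Eventually.of_forall fun m => by
        have hm : (0 : ℝ) ≤ 1 / ((m : ℝ) + 1) := by positivity
        have hm1 : 1 / ((m : ℝ) + 1) ≤ 1 := by
          rw [div_le_one (by positivity)]
          linarith [(Nat.cast_nonneg m : (0 : ℝ) ≤ m)]
        exact (convex_Icc _ _).add_smul_sub_mem hx hy ⟨hm, hm1⟩)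
      (by
        refine tendsto_const_nhds.congr fun m => ?_
        have : (m : ℝ) + 1 ≠ 0 := by positivity
        rw [smul_smul, mul_one_div_cancel this, one_smul])
    refine le_of_tendsto ht.norm (Filter.Eventually.of_forall fun m => ?_)
    have hm : (0 : ℝ) < (m : ℝ) + 1 := by positivity
    have := hl (x + (1 / ((m : ℝ) + 1)) • (y - x)) x
    rw [norm_smul, Real.norm_of_nonneg hm.le]
    rw [add_sub_cancel_left, norm_smul, Real.norm_of_nonneg (by positivity)] at this
    calc _ ≤ ((m : ℝ) + 1) * (K * (1 / ((m : ℝ) + 1) * ‖y - x‖)) := by gcongr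
      _ = _ := by field_simp
  refine ContinuousLinearMap.opNorm_le_bound _ (by positivity) fun w => ?_
  have hsmall : ∀ v : Fin n → ℝ, ‖v‖ ≤ 1 / 2 → ‖A v‖ ≤ 2 * K := by
    intro v hv
    have hc : (fun _ => 1 / 2 : Fin n → ℝ) ∈ Icc (0 : Fin n → ℝ) 1 :=
      ⟨fun i => by norm_num, fun i => by norm_num⟩
    have hcv : (fun i => 1 / 2 + v i : Fin n → ℝ) ∈ Icc (0 : Fin n → ℝ) 1 := by
      have : ∀ i, |v i| ≤ 1 / 2 := fun i => (norm_le_pi_norm v i).trans hv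
      constructor
      · intro i; have := (abs_le.1 (this i)).1; simp only [Pi.zero_apply]; linarith
      · intro i; have := (abs_le.1 (this i)).2; simp only [Pi.one_apply]; linarith
    have hn : ∀ y ∈ Icc (0 : Fin n → ℝ) 1, ‖y - x‖ ≤ 1 := by
      intro y hy
      refine (pi_norm_le_iff_of_nonneg zero_le_one).2 fun i => ?_
      have a1 := hy.1 i
      have a2 := hy.2 i
      have a3 := hx.1 i
      have a4 := hx.2 i
      simp only [Pi.zero_apply, Pi.one_apply] at a1 a2 a3 a4
      rw [Pi.sub_apply, Real.norm_eq_abs, abs_le]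
      constructor <;> linarith
    have e1 : v = ((fun i => 1 / 2 + v i : Fin n → ℝ) - x) - ((fun _ => 1 / 2 : Fin n → ℝ) - x) := by
      funext i; simp
    have b1 := h1 _ hcv
    have b2 := h1 _ hc
    have b3 := hn _ hcv
    have b4 := hn _ hc
    rw [e1, map_sub]
    refine (norm_sub_le _ _).trans ?_
    nlinarith
  by_cases hw : w = 0
  · simp [hw]
  have hw' : 0 < ‖w‖ := norm_pos_iff.2 hw
  have := hsmall ((1 / (2 * ‖w‖)) • w) (by
    rw [norm_smul, Real.norm_of_nonneg (by positivity)]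
    apply le_of_eq; field_simp)
  rw [map_smul, norm_smul, Real.norm_of_nonneg (by positivity), div_mul_eq_mul_div,
    div_le_iff₀ (by positivity)] at this
  linarith

theorem cube_uniqueDiffOn (n : ℕ) : UniqueDiffOn ℝ (Icc (0 : Fin n → ℝ) 1) := by
  rw [← pi_univ_Icc]
  exact UniqueDiffOn.univ_pi fun i => uniqueDiffOn_Icc zero_lt_one

theorem WB.iter {n d : ℕ} {V : Type} [NormedAddCommGroup V] [NormedSpace ℝ V] {ε η : ℝ}
    (hη : 0 ≤ η) {e : (Fin n → ℝ) → V} (h : WB d V ε η e) {m : ℕ} (hm : m ≤ d + 1)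
    {x : Fin n → ℝ} (hx : x ∈ Icc (0 : Fin n → ℝ) 1) :
    ‖iteratedFDerivWithin ℝ m e (Icc (0 : Fin n → ℝ) 1) x‖ ≤ 4 * ε * η ^ m := by
  have h0 := h.nonneg
  induction m generalizing d V ε with
  | zero =>
    rw [norm_iteratedFDerivWithin_zero]
    have := h.bd x
    simp; linarith
  | succ m ih =>
    cases d with
    | zero =>
      have : m = 0 := by omega
      subst this
      simp only [Nat.zero_add]
      rw [norm_iteratedFDerivWithin_one _ (cube_uniqueDiffOn n x hx)]
      have := cube_fderivWithin_le (mul_nonneg h0 hη) h.lip hx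
      rw [pow_one]; linarith
    | succ d =>
      rw [← norm_iteratedFDerivWithin_fderivWithin (cube_uniqueDiffOn n) hx]
      have e1 : EqOn (fderivWithin ℝ e (Icc (0 : Fin n → ℝ) 1)) (fderiv ℝ e)
          (Icc (0 : Fin n → ℝ) 1) := fun y hy =>
        (h.2.1 y).fderivWithin (cube_uniqueDiffOn n y hy)
      rw [iteratedFDerivWithin_congr e1 hx]
      have := ih h.2.2 (by omega) h.2.2.nonneg
      rw [pow_succ']; linarith

theorem exists_common {ι : Type} [Fintype ι] (f : ι → ℝ) : ∃ M, 0 ≤ M ∧ ∀ i, f i ≤ M :=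
  ⟨∑ i, |f i|, Finset.sum_nonneg fun i _ => abs_nonneg _, fun i => (le_abs_self _).trans
    (Finset.single_le_sum (f := fun i => |f i|) (fun i _ => abs_nonneg _) (Finset.mem_univ i))⟩

theorem kan_layers {d L : ℕ} {n : ℕ → ℕ} {N : ℕ}
    {ψ : (l : ℕ) → Fin (n (l + 1)) → Fin (n l) → ℝ → ℝ}
    {s : (l : ℕ) → Fin (n (l + 1)) → Fin (n l) → ℕ → ℝ → ℝ}
    {M C : (l : ℕ) → Fin (n (l + 1)) → Fin (n l) → ℝ}
    (hψ : ∀ l, l < L → ∀ j i, WB (d + 1) ℝ (M l j i) 1 (ψ l j i))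
    (hs : ∀ l, l < L → ∀ j i, ∀ G : ℕ, 1 ≤ G → WB d ℝ (M l j i) 1 (s l j i G) ∧
        WB d ℝ (C l j i * ((G : ℝ) ^ (d + 2))⁻¹) G (fun x => ψ l j i x - s l j i G x))
    (F : (Fin N → ℝ) → (Fin (n 0) → ℝ)) {M₀ : ℝ} (hF : ∀ i, WB d ℝ M₀ 1 (fun x => F x i))
    (hM₀ : 0 ≤ M₀) (l : ℕ) (hl : l ≤ L) :
    ∃ M C : ℝ, 0 ≤ M ∧ 0 ≤ C ∧ ∀ G : ℕ, 1 ≤ G → ∀ i,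
      WB d ℝ M 1 (fun x => kanComp n ψ l (F x) i) ∧
      WB d ℝ M 1 (fun x => kanComp n (fun l j i => s l j i G) l (F x) i) ∧
      WB d ℝ (C * ((G : ℝ) ^ (d + 2))⁻¹) G
        (fun x => kanComp n ψ l (F x) i - kanComp n (fun l j i => s l j i G) l (F x) i) := by
  induction l with
  | zero =>
    refine ⟨M₀, 0, hM₀, le_rfl, fun G hG i => ⟨hF i, hF i, ?_⟩⟩
    simp only [kanComp, id, sub_self, zero_mul]
    exact WB.zero le_rfl (by positivity)
  | succ l ih =>
    obtain ⟨M₁, C₁, hM₁, hC₁, H⟩ := ih (by omega)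
    obtain ⟨M₂, hM₂, hM₂'⟩ := exists_common (fun p : Fin (n (l + 1)) × Fin (n l) => M l p.1 p.2)
    obtain ⟨C₂, hC₂, hC₂'⟩ := exists_common (fun p : Fin (n (l + 1)) × Fin (n l) => C l p.1 p.2)
    set M₃ := M₁ + M₂ with hM₃
    have hM₃0 : 0 ≤ M₃ := by positivity
    obtain ⟨A, hA, HA⟩ := WB.comp (E := Fin N → ℝ) (V₁ := ℝ) (d := d) M₃ hM₃0
    obtain ⟨B, hB, HB⟩ := WB.comp_sub (E := Fin N → ℝ) (V₁ := ℝ) (d := d) M₃ hM₃0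
    refine ⟨∑ _i : Fin (n l), A * M₃, ∑ _i : Fin (n l), (B * C₁ + A * C₂), by positivity,
      by positivity, fun G hG j => ?_⟩
    have hG1 : (1 : ℝ) ≤ G := by exact_mod_cast hG
    have hMle : ∀ i, M l j i ≤ M₃ := fun i => (hM₂' (j, i)).trans (by linarith)
    have f1 : ∀ i, WB d ℝ M₃ 1 (fun x => kanComp n ψ l (F x) i) := fun i =>
      (H G hG i).1.mono (by linarith) zero_le_one le_rfl
    have f2 : ∀ i, WB d ℝ M₃ 1 (fun x => kanComp n (fun l j i => s l j i G) l (F x) i) := fun i =>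
      (H G hG i).2.1.mono (by linarith) zero_le_one le_rfl
    have g1 : ∀ i, WB (d + 1) ℝ M₃ 1 (ψ l j i) := fun i =>
      (hψ l (by omega) j i).mono (hMle i) zero_le_one le_rfl
    have g2 : ∀ i, WB d ℝ M₃ 1 (s l j i G) := fun i =>
      (hs l (by omega) j i G hG).1.mono (hMle i) zero_le_one le_rfl
    have g3 : ∀ i, WB d ℝ (C₂ * ((G : ℝ) ^ (d + 2))⁻¹) G (fun x => ψ l j i x - s l j i G x) :=
      fun i => (hs l (by omega) j i G hG).2.mono
        (mul_le_mul_of_nonneg_right (hC₂' (j, i)) (by positivity)) (by linarith) le_rfl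
    refine ⟨?_, ?_, ?_⟩
    · exact WB.sum zero_le_one _ fun i _ => HA _ _ _ le_rfl _ _ (g1 i).pred (f1 i)
    · exact WB.sum zero_le_one _ fun i _ => HA _ _ _ le_rfl _ _ (g2 i) (f2 i)
    · have key := WB.sum (E := Fin N → ℝ) (d := d) (V := ℝ) (η := G) (by linarith)
        (Finset.univ : Finset (Fin (n l)))
        (fun i _ => (HB _ _ _ hG1 _ _ _ (g1 i) (f1 i) (f2 i) (H G hG i).2.2).add
          (HA _ _ _ hG1 _ _ (g3 i) (f2 i)))
      convert key using 1
      · rw [Finset.sum_mul]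
        refine Finset.sum_congr rfl fun i _ => ?_
        ring
      · funext x
        simp only [kanComp, kanLayer]
        rw [← Finset.sum_sub_distrib]
        refine Finset.sum_congr rfl fun i _ => ?_
        ring

theorem kanComp_continuous {L : ℕ} {n : ℕ → ℕ} {φ : (l : ℕ) → Fin (n (l + 1)) → Fin (n l) → ℝ → ℝ}
    (hφ : ∀ l, l < L → ∀ j i, Continuous (φ l j i)) (l : ℕ) (hl : l ≤ L) :
    Continuous (kanComp n φ l) := by
  induction l with
  | zero => exact continuous_id
  | succ l ih =>
    have h1 := ih (by omega)
    refine continuous_pi fun j => ?_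
    simp only [kanComp, kanLayer]
    refine continuous_finsetSum _ fun i _ => ?_
    exact (hφ l (by omega) j i).comp ((continuous_apply i).comp h1)

end KanFinal

/-- **KAN approximation bound (Theorem 1 of Liu et al.).**
If `f = Φ_{L-1} ∘ ⋯ ∘ Φ_0` is a KAN whose univariate functions `φ l j i` are
`(k+1)`-times continuously differentiable, then there is a constant `C > 0`
(depending on `f` and the representation) such that for every grid size `G ≥ 1`
there are degree-`k` splines `φG l j i` on uniform grids with `G` subintervals of
bounded intervals containing the ranges of the corresponding intermediate
coordinates, such that for every `0 ≤ m ≤ k` the `C^m` norm over `[0,1]^{n_0}` of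
`f - Φ^G_{L-1} ∘ ⋯ ∘ Φ^G_0` is at most `C · G^{-k-1+m}`. -/
theorem kan_approximation_bound
    (k : ℕ) (hk : 1 ≤ k) (L : ℕ) (n : ℕ → ℕ) (hnL : n L = 1)
    (φ : (l : ℕ) → Fin (n (l + 1)) → Fin (n l) → ℝ → ℝ)
    (hφ : ∀ l, l < L → ∀ (j : Fin (n (l + 1))) (i : Fin (n l)),
      ContDiff ℝ (k + 1 : ℕ) (φ l j i))
    (f : (Fin (n 0) → ℝ) → ℝ)
    (hf : ∀ x, f x = kanComp n φ L x ⟨0, by omega⟩) :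
    ∃ C : ℝ, 0 < C ∧ ∀ G : ℕ, 1 ≤ G →
      ∃ φG : (l : ℕ) → Fin (n (l + 1)) → Fin (n l) → ℝ → ℝ,
        (∀ l, l < L → ∀ (j : Fin (n (l + 1))) (i : Fin (n l)),
          ∃ a b : ℝ, a < b ∧
            (∀ x ∈ Icc (0 : Fin (n 0) → ℝ) 1, kanComp n φ l x i ∈ Icc a b) ∧
            IsUniformSplineOn (φG l j i) k G a b) ∧
        ∀ m : ℕ, m ≤ k → ∀ x ∈ Icc (0 : Fin (n 0) → ℝ) 1,
          ‖iteratedFDerivWithin ℝ m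
              (fun y => f y - kanComp n φG L y ⟨0, by omega⟩)
              (Icc (0 : Fin (n 0) → ℝ) 1) x‖ ≤
            C * (G : ℝ) ^ (-(k : ℤ) - 1 + m) := by
  obtain ⟨d, rfl⟩ : ∃ d, k = d + 1 := ⟨k - 1, by omega⟩
  have hcont : ∀ l, l ≤ L → Continuous (kanComp n φ l) :=
    kanComp_continuous fun l hl j i => (hφ l hl j i).continuous
  have hdata : ∀ (l : ℕ) (j : Fin (n (l + 1))) (i : Fin (n l)),
      ∃ (a b : ℝ) (ψ : ℝ → ℝ) (s : ℕ → ℝ → ℝ) (M C : ℝ), l < L → a < b ∧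
        (∀ x ∈ Icc (0 : Fin (n 0) → ℝ) 1, kanComp n φ l x i ∈ Icc a b) ∧
        EqOn ψ (φ l j i) (Icc a b) ∧ WB (d + 1) ℝ M 1 ψ ∧
        ∀ G : ℕ, 1 ≤ G → IsUniformSplineOn (s G) (d + 1) G a b ∧ WB d ℝ M 1 (s G) ∧
          WB d ℝ (C * ((G : ℝ) ^ (d + 2))⁻¹) G (fun x => ψ x - s G x) := by
    intro l j i
    by_cases hl : l < L
    swap
    · exact ⟨0, 0, 0, 0, 0, 0, fun h => absurd h hl⟩
    obtain ⟨R, hR⟩ := (isCompact_Icc (a := (0 : Fin (n 0) → ℝ)) (b := 1)).exists_bound_of_continuousOn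
      (f := fun x => kanComp n φ l x i)
      ((continuous_apply i).comp (hcont l hl.le)).continuousOn
    have hR0 : 0 ≤ R := (norm_nonneg _).trans (hR 0 ⟨le_rfl, zero_le_one⟩)
    obtain ⟨ψ, s, M, C, h1, h2, h3⟩ := kan_single (hφ l hl j i) (a := -(R + 1)) (b := R + 1)
      (by linarith)
    refine ⟨-(R + 1), R + 1, ψ, s, M, C, fun _ => ⟨by linarith, fun x hx => ?_, h1, h2, h3⟩⟩
    have := abs_le.1 (hR x hx)
    exact ⟨by linarith [this.1], by linarith [this.2]⟩
  choose a b ψ s M C hall using hdata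
  let χ : ContDiffBump (0 : Fin (n 0) → ℝ) := ⟨1, 2, by norm_num, by norm_num⟩
  set F : (Fin (n 0) → ℝ) → (Fin (n 0) → ℝ) := fun x => χ x • x with hFdef
  have hFeq : ∀ x ∈ Icc (0 : Fin (n 0) → ℝ) 1, F x = x := by
    intro x hx
    have : χ x = 1 := χ.one_of_mem_closedBall (by
      rw [mem_closedBall_zero_iff]
      change ‖x‖ ≤ 1
      refine (pi_norm_le_iff_of_nonneg zero_le_one).2 fun i => ?_
      have a1 := hx.1 i
      have a2 := hx.2 i
      simp only [Pi.zero_apply, Pi.one_apply] at a1 a2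
      rw [Real.norm_eq_abs, abs_le]
      constructor <;> linarith)
    simp [hFdef, this]
  have hFW : ∀ i, ∃ M, WB d ℝ M 1 (fun x => F x i) := by
    intro i
    refine WB.of_compact ?_ ?_
    · have : ContDiff ℝ (d + 1 : ℕ) F := χ.contDiff.smul contDiff_id
      exact contDiff_pi.1 this i
    · have : HasCompactSupport F := χ.hasCompactSupport.smul_right
      exact this.comp_left (g := fun v : Fin (n 0) → ℝ => v i) rfl
  choose MF hMF using hFW
  obtain ⟨M₀, hM₀, hM₀'⟩ := exists_common MF
  obtain ⟨M₁, C₁, hM₁, hC₁, H⟩ := kan_layers (L := L) (n := n) (ψ := ψ) (s := s) (M := M) (C := C)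
    (d := d) (fun l hl j i => (hall l j i hl).2.2.2.1)
    (fun l hl j i G hG => ((hall l j i hl).2.2.2.2 G hG).2) F
    (fun i => (hMF i).mono (hM₀' i) zero_le_one le_rfl) hM₀ L le_rfl
  have heq : ∀ l, l ≤ L → ∀ x ∈ Icc (0 : Fin (n 0) → ℝ) 1, kanComp n ψ l x = kanComp n φ l x := by
    intro l
    induction l with
    | zero => intro _ x _; rfl
    | succ l ih =>
      intro hl x hx
      funext j
      simp only [kanComp, kanLayer]
      rw [ih (by omega) x hx]
      refine Finset.sum_congr rfl fun i _ => ?_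
      exact (hall l j i (by omega)).2.2.1 ((hall l j i (by omega)).2.1 x hx)
  refine ⟨4 * C₁ + 1, by positivity, fun G hG => ⟨fun l j i => s l j i G, ?_, ?_⟩⟩
  · intro l hl j i
    have := hall l j i hl
    exact ⟨a l j i, b l j i, this.1, this.2.1, (this.2.2.2.2 G hG).1⟩
  · intro m hm x hx
    have hG0 : (0 : ℝ) < G := by exact_mod_cast hG
    have w := (H G hG ⟨0, by omega⟩).2.2
    have hcongr : EqOn (fun y => f y - kanComp n (fun l j i => s l j i G) L y ⟨0, by omega⟩)
        (fun y => kanComp n ψ L (F y) ⟨0, by omega⟩ -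
          kanComp n (fun l j i => s l j i G) L (F y) ⟨0, by omega⟩)
        (Icc (0 : Fin (n 0) → ℝ) 1) := by
      intro y hy
      simp only [hFeq y hy, hf, heq L le_rfl y hy]
    rw [iteratedFDerivWithin_congr hcongr hx]
    refine (w.iter hG0.le hm hx).trans ?_
    have e1 : (G : ℝ) ^ (-((d + 1 : ℕ) : ℤ) - 1 + m) = ((G : ℝ) ^ (d + 2))⁻¹ * (G : ℝ) ^ m := by
      rw [zpow_add₀ hG0.ne', zpow_natCast, ← zpow_natCast (G : ℝ) (d + 2), ← zpow_neg]
      congr 2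
    rw [e1]
    have : 0 ≤ ((G : ℝ) ^ (d + 2))⁻¹ * (G : ℝ) ^ m := by positivity
    nlinarith
end

section
/- B-splines are a basis for splines (Curry–Schoenberg, simple knots): let t_0 < t_1 < ⋯ < t_m be a strictly increasing knot vector and let p ≥ 1 with 2p < m. Let S be the real vector space of functions s : [t_p, t_{m−p}] → ℝ that are (p−1)-times continuously differentiable on [t_p, t_{m−p}] and whose restriction to each subinterval [t_j, t_{j+1}], p ≤ j ≤ m−p−1, agrees with a polynomial of degree at most p. Then the restrictions to [t_p, t_{m−p}] of the B-spline basis functions B_{0,p}, B_{1,p}, …, B_{m−p−1,p} form a basis of S; in particular, every s ∈ S can be written as s(x) = Σ_{i=0}^{m−p−1} α_i B_{i,p}(x) on [t_p, t_{m−p}] for a unique choice of coefficients α_0, …, α_{m−p−1} ∈ ℝ. -/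
/-- Cox–de Boor B-spline basis functions for knot vector `t`.  Degree `0`:
`B_{i,0}(x) = 1` on `[t i, t (i+1))` and `0` otherwise;  degree `p+1`:
`B_{i,p+1}(x) = (x − t i)/(t (i+p+1) − t i) · B_{i,p}(x)
  + (t (i+p+2) − x)/(t (i+p+2) − t (i+1)) · B_{i+1,p}(x)`,
where (by the convention `a / 0 = 0` of real division in Lean) any term whose
denominator vanishes is `0`. -/
noncomputable def bspline (t : ℕ → ℝ) : ℕ → ℕ → ℝ → ℝ
  | i, 0 => fun x => if t i ≤ x ∧ x < t (i + 1) then 1 else 0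
  | i, (p + 1) => fun x =>
      (x - t i) / (t (i + p + 1) - t i) * bspline t i p x +
      (t (i + p + 2) - x) / (t (i + p + 2) - t (i + 1)) * bspline t (i + 1) p x

open Polynomial in
/-- `Q_{i,p} = ∏_{k=1}^{p} (X + t_{i+k})`. -/
noncomputable def bsQ (t : ℕ → ℝ) (i p : ℕ) : ℝ[X] :=
  ∏ k ∈ Finset.range p, (X + C (t (i + 1 + k)))

/-- The dual functional (blossom evaluated at `t_{i+1}, …, t_{i+p}`). -/
noncomputable def bsL (t : ℕ → ℝ) (i p : ℕ) (P : Polynomial ℝ) : ℝ :=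
  ∑ k ∈ Finset.range (p + 1), P.coeff k * ((bsQ t i p).coeff (p - k) / (p.choose k : ℝ))

theorem bs_zero_left {t : ℕ → ℝ} (ht : StrictMono t) (p : ℕ) :
    ∀ (i : ℕ) (x : ℝ), x < t i → bspline t i p x = 0 := by
  induction p with
  | zero => intro i x hx; simp [bspline, hx]
  | succ p ih =>
    intro i x hx
    have h2 : t i < t (i + 1) := ht (by omega)
    simp [bspline, ih i x hx, ih (i + 1) x (hx.trans h2)]

theorem bs_zero_right {t : ℕ → ℝ} (ht : StrictMono t) (p : ℕ) :
    ∀ (i : ℕ) (x : ℝ), t (i + p + 1) ≤ x → bspline t i p x = 0 := by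
  induction p with
  | zero =>
    intro i x hx
    have : ¬ x < t (i + 1) := not_lt.2 hx
    simp [bspline, this]
  | succ p ih =>
    intro i x hx
    have h2 : t (i + p + 1) < t (i + (p + 1) + 1) := ht (by omega)
    have h3 : t (i + 1 + p + 1) ≤ x := by
      have : i + 1 + p + 1 = i + (p + 1) + 1 := by omega
      rw [this]; exact hx
    simp [bspline, ih i x (h2.le.trans hx), ih (i + 1) x h3]

theorem bs_zero_knot {t : ℕ → ℝ} (ht : StrictMono t) (p : ℕ) (hp : 1 ≤ p) (i : ℕ) :
    bspline t i p (t i) = 0 := by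
  obtain ⟨p, rfl⟩ : ∃ k, p = k + 1 := ⟨p - 1, by omega⟩
  simp [bspline, bs_zero_left ht p (i + 1) (t i) (ht (by omega))]

theorem bs_congr {t u : ℕ → ℝ} {m : ℕ} (h : ∀ j, j ≤ m → t j = u j) (p : ℕ) :
    ∀ i, i + p + 1 ≤ m → ∀ x, bspline t i p x = bspline u i p x := by
  induction p with
  | zero => intro i hi x; simp [bspline, h i (by omega), h (i + 1) (by omega)]
  | succ p ih =>
    intro i hi x
    simp only [bspline]
    rw [ih i (by omega), ih (i + 1) (by omega), h i (by omega), h (i + 1) (by omega),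
      h (i + p + 1) (by omega), h (i + p + 2) (by omega)]

theorem bsQ_succ (t : ℕ → ℝ) (i p : ℕ) :
    bsQ t i (p + 1) = bsQ t i p * (Polynomial.X + Polynomial.C (t (i + p + 1))) := by
  rw [bsQ, Finset.prod_range_succ, bsQ]
  congr 4; omega

theorem bsQ_succ_left (t : ℕ → ℝ) (i p : ℕ) :
    bsQ t i (p + 1) = bsQ t (i + 1) p * (Polynomial.X + Polynomial.C (t (i + 1))) := by
  rw [bsQ, Finset.prod_range_succ', bsQ]
  congr 1
  apply Finset.prod_congr rfl
  intro k _
  congr 3; omega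

open Polynomial in
theorem marsden {t : ℕ → ℝ} (ht : StrictMono t) (p : ℕ) :
    ∀ (q : ℕ) (x : ℝ), t (q + p) ≤ x → x < t (q + p + 1) →
      ∑ r ∈ Finset.range (p + 1), C (bspline t (q + r) p x) * bsQ t (q + r) p
        = (X + C x) ^ p := by
  induction p with
  | zero =>
    intro q x h1 h2
    simp only [add_zero] at h1 h2
    rw [zero_add, Finset.sum_range_one]
    simp [bspline, bsQ, h1, h2]
  | succ p ih =>
    intro q x h1 h2
    have e1 : q + (p + 1) = q + 1 + p := by omega
    rw [e1] at h1 h2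
    have IH := ih (q + 1) x h1 h2
    have hz1 : bspline t q p x = 0 := by
      apply bs_zero_right ht
      have : q + p + 1 = q + 1 + p := by omega
      rw [this]; exact h1
    have hz2 : bspline t (q + (p + 1) + 1) p x = 0 := by
      apply bs_zero_left ht
      rw [e1]; exact h2
    have key : ∀ r, C (bspline t (q + r) (p + 1) x) * bsQ t (q + r) (p + 1)
        = C ((x - t (q + r)) / (t (q + r + p + 1) - t (q + r)) * bspline t (q + r) p x)
            * bsQ t (q + r) (p + 1)
          + C ((t (q + r + p + 2) - x) / (t (q + r + p + 2) - t (q + r + 1))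
              * bspline t (q + r + 1) p x) * bsQ t (q + r) (p + 1) := by
      intro r
      rw [← add_mul, ← C_add]; rfl
    rw [Finset.sum_congr rfl (fun r _ => key r), Finset.sum_add_distrib,
      Finset.sum_range_succ', Finset.sum_range_succ (n := p + 1)]
    rw [hz2]
    simp only [add_zero, hz1, mul_zero, C_0, zero_mul]
    rw [← Finset.sum_add_distrib, pow_succ, ← IH, Finset.sum_mul]
    apply Finset.sum_congr rfl
    intro r _
    have e2 : q + (r + 1) = q + r + 1 := by omega
    have e3 : q + 1 + r = q + r + 1 := by omega
    have e4 : q + r + 1 + p + 1 = q + r + p + 2 := by omega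
    rw [e2, e3, bsQ_succ_left t (q + r), bsQ_succ t (q + r + 1), e4]
    have hd : t (q + r + p + 2) - t (q + r + 1) ≠ 0 :=
      sub_ne_zero.2 (ht (show q + r + 1 < q + r + p + 2 by omega)).ne'
    set a := t (q + r + p + 2)
    set b := t (q + r + 1)
    set B := bspline t (q + r + 1) p x
    set R := bsQ t (q + r + 1) p
    have hw : (a - x) / (a - b) = 1 - (x - b) / (a - b) := by field_simp; ring
    have hx : (C x : ℝ[X]) = C ((x - b) / (a - b)) * (C a - C b) + C b := by
      rw [← C_sub, ← C_mul, ← C_add]; congr 1; field_simp; ring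
    rw [hw, hx]
    simp only [C_mul, C_sub, C_1]
    ring

open Polynomial in
theorem marsden_closed {t : ℕ → ℝ} (ht : StrictMono t) (p : ℕ) (hp : 1 ≤ p)
    (q : ℕ) (x : ℝ) (h1 : t (q + p) ≤ x) (h2 : x ≤ t (q + p + 1)) :
      ∑ r ∈ Finset.range (p + 1), C (bspline t (q + r) p x) * bsQ t (q + r) p
        = (X + C x) ^ p := by
  rcases h2.lt_or_eq with h | h
  · exact marsden ht p q x h1 h
  · have e : q + p + 1 = q + 1 + p := by omega
    have := marsden ht p (q + 1) x (by rw [← e, h]) (by rw [← e, h]; exact ht (by omega))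
    rw [← this, Finset.sum_range_succ', Finset.sum_range_succ]
    have z1 : bspline t (q + 0) p x = 0 := bs_zero_right ht _ _ _ (by rw [h]; simp)
    have z2 : bspline t (q + 1 + p) p x = 0 := by
      rw [h, e]; exact bs_zero_knot ht p hp _
    rw [z1, z2]
    simp only [C_0, zero_mul, add_zero]
    apply Finset.sum_congr rfl
    intro r _
    rw [show q + (r + 1) = q + 1 + r by omega]

theorem local_rep {t : ℕ → ℝ} (ht : StrictMono t) (p : ℕ) (hp : 1 ≤ p)
    (q : ℕ) (x : ℝ) (h1 : t (q + p) ≤ x) (h2 : x ≤ t (q + p + 1))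
    (P : Polynomial ℝ) (hP : P.degree ≤ (p : ℕ)) :
    P.eval x = ∑ r ∈ Finset.range (p + 1), bsL t (q + r) p P * bspline t (q + r) p x := by
  have hM := marsden_closed ht p hp q x h1 h2
  have hc : ∀ k, k ≤ p → x ^ k * (p.choose k : ℝ)
      = ∑ r ∈ Finset.range (p + 1), bspline t (q + r) p x * (bsQ t (q + r) p).coeff (p - k) := by
    intro k hk
    have := congrArg (fun R => Polynomial.coeff R (p - k)) hM
    simp only [Polynomial.finsetSum_coeff, Polynomial.coeff_C_mul,
      Polynomial.coeff_X_add_C_pow] at this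
    rw [this, Nat.choose_symm hk, Nat.sub_sub_self hk]
  rw [Polynomial.eval_eq_sum_range' (n := p + 1)
    (Nat.lt_succ_of_le (Polynomial.natDegree_le_of_degree_le hP))]
  simp only [bsL, Finset.sum_mul]
  rw [Finset.sum_comm]
  apply Finset.sum_congr rfl
  intro k hk
  have hk' : k ≤ p := by simp at hk; omega
  have hne : (p.choose k : ℝ) ≠ 0 := by
    exact_mod_cast (Nat.choose_pos hk').ne'
  have : x ^ k = (∑ r ∈ Finset.range (p + 1),
      bspline t (q + r) p x * (bsQ t (q + r) p).coeff (p - k)) / (p.choose k : ℝ) := by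
    rw [← hc k hk']; field_simp
  rw [this, Finset.sum_div, Finset.mul_sum]
  apply Finset.sum_congr rfl
  intro r _
  ring

theorem bsQ_natDegree (t : ℕ → ℝ) (i p : ℕ) : (bsQ t i p).natDegree < p + 1 := by
  rw [bsQ, Polynomial.natDegree_prod_of_monic _ _ (fun k _ => Polynomial.monic_X_add_C _)]
  simp

theorem bsL_pow (t : ℕ → ℝ) (i p : ℕ) (a : ℝ) :
    bsL t i p ((Polynomial.X - Polynomial.C a) ^ p) = (bsQ t i p).eval (-a) := by
  rw [Polynomial.eval_eq_sum_range' (bsQ_natDegree t i p), bsL, ← Finset.sum_range_reflect]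
  apply Finset.sum_congr rfl
  intro k hk
  have hk' : k ≤ p := by simp at hk; omega
  have e : p + 1 - 1 - k = p - k := by omega
  rw [e, sub_eq_add_neg, ← Polynomial.C_neg, Polynomial.coeff_X_add_C_pow, Nat.sub_sub_self hk',
    ]
  have hne : (p.choose (p - k) : ℝ) ≠ 0 := by
    exact_mod_cast (Nat.choose_pos (Nat.sub_le _ _)).ne'
  field_simp

theorem bsL_sub (t : ℕ → ℝ) (i p : ℕ) (P Q : Polynomial ℝ) :
    bsL t i p (P - Q) = bsL t i p P - bsL t i p Q := by
  simp [bsL, sub_mul]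

theorem bsL_C_mul (t : ℕ → ℝ) (i p : ℕ) (c : ℝ) (P : Polynomial ℝ) :
    bsL t i p (Polynomial.C c * P) = c * bsL t i p P := by
  simp [bsL, Finset.mul_sum, mul_assoc]

theorem bsL_eq_of_dvd (t : ℕ → ℝ) (i p j : ℕ) (h1 : i + 1 ≤ j) (h2 : j ≤ i + p)
    (P Q : Polynomial ℝ) (hP : P.degree ≤ (p : ℕ)) (hQ : Q.degree ≤ (p : ℕ))
    (hd : (Polynomial.X - Polynomial.C (t j)) ^ p ∣ P - Q) :
    bsL t i p P = bsL t i p Q := by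
  obtain ⟨R, hR⟩ := hd
  have hdeg : (P - Q).natDegree ≤ p :=
    Polynomial.natDegree_le_of_degree_le ((Polynomial.degree_sub_le _ _).trans (max_le hP hQ))
  have hm : ((Polynomial.X - Polynomial.C (t j)) ^ p).Monic :=
    (Polynomial.monic_X_sub_C _).pow p
  have hR0 : R = Polynomial.C (R.coeff 0) := by
    by_cases h0 : R = 0
    · simp [h0]
    · apply Polynomial.eq_C_of_natDegree_eq_zero
      rw [hR, hm.natDegree_mul' h0, Polynomial.natDegree_pow, Polynomial.natDegree_X_sub_C] at hdeg
      omega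
  rw [← sub_eq_zero, ← bsL_sub, hR, hR0, mul_comm, bsL_C_mul, bsL_pow]
  have : (bsQ t i p).eval (-(t j)) = 0 := by
    rw [bsQ, Polynomial.eval_prod]
    apply Finset.prod_eq_zero (i := j - (i + 1))
    · simp; omega
    · simp [show i + 1 + (j - (i + 1)) = j by omega]
  rw [this, mul_zero]

theorem dvd_of_derivative (R : Polynomial ℝ) (c : ℝ) (n : ℕ) (h0 : R.eval c = 0)
    (hd : (Polynomial.X - Polynomial.C c) ^ n ∣ R.derivative) :
    (Polynomial.X - Polynomial.C c) ^ (n + 1) ∣ R := by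
  by_cases hR : R = 0
  · simp [hR]
  have hD : R.derivative ≠ 0 := by
    intro h
    have := Polynomial.derivative_eq_zero.1 h
    rw [Polynomial.eq_C_of_natDegree_eq_zero this] at h0 hR
    simp at h0 hR
    exact hR h0
  rw [← Polynomial.le_rootMultiplicity_iff hD,
    Polynomial.derivative_rootMultiplicity_of_root h0] at hd
  rw [← Polynomial.le_rootMultiplicity_iff hR]
  have := (Polynomial.rootMultiplicity_pos hR).2 h0
  omega

theorem dvd_of_contDiffOn (a c b : ℝ) (hac : a < c) (hcb : c < b) (n : ℕ) :
    ∀ (f : ℝ → ℝ) (P Q : Polynomial ℝ), ContDiffOn ℝ n f (Set.Icc a b) →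
      (∀ x ∈ Set.Icc a c, f x = P.eval x) → (∀ x ∈ Set.Icc c b, f x = Q.eval x) →
      (Polynomial.X - Polynomial.C c) ^ (n + 1) ∣ P - Q := by
  induction n with
  | zero =>
    intro f P Q _ hP hQ
    rw [zero_add, pow_one, Polynomial.dvd_iff_isRoot]
    simp [← hP c ⟨hac.le, le_rfl⟩, ← hQ c ⟨le_rfl, hcb.le⟩]
  | succ n ih =>
    intro f P Q hf hP hQ
    have hab := hac.trans hcb
    have hud := uniqueDiffOn_Icc hab
    apply dvd_of_derivative
    · simp [← hP c ⟨hac.le, le_rfl⟩, ← hQ c ⟨le_rfl, hcb.le⟩]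
    · rw [Polynomial.derivative_sub]
      push_cast at hf
      have hdiff : DifferentiableOn ℝ f (Set.Icc a b) := hf.differentiableOn (by simp)
      have aux : ∀ (u v : ℝ) (R : Polynomial ℝ), u < v → a ≤ u → v ≤ b →
          (∀ x ∈ Set.Icc u v, f x = R.eval x) →
          ∀ x ∈ Set.Icc u v, derivWithin f (Set.Icc a b) x = R.derivative.eval x := by
        intro u v R huv hau hvb hR x hx
        have hsub : Set.Icc u v ⊆ Set.Icc a b := Set.Icc_subset_Icc hau hvb
        have d1 := ((hdiff x (hsub hx)).hasDerivWithinAt).mono hsub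
        have d2 : HasDerivWithinAt f (R.derivative.eval x) (Set.Icc u v) x :=
          (R.hasDerivAt x).hasDerivWithinAt.congr hR (hR x hx)
        exact (uniqueDiffOn_Icc huv x hx).eq_deriv _ d1 d2
      apply ih (derivWithin f (Set.Icc a b)) _ _
        ((contDiffOn_succ_iff_derivWithin hud).1 hf).2.2
      · exact aux a c P hac le_rfl hcb.le hP
      · exact aux c b Q hcb hac.le le_rfl hQ

theorem sum_restrict (N q p : ℕ) (h : q + p + 1 ≤ N) (g : ℕ → ℝ)
    (h1 : ∀ i, i < q → g i = 0) (h2 : ∀ i, q + p < i → g i = 0) :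
    ∑ i : Fin N, g i = ∑ r ∈ Finset.range (p + 1), g (q + r) := by
  rw [Fin.sum_univ_eq_sum_range]
  have := Finset.sum_Ico_eq_sum_range g q (q + p + 1)
  rw [show q + p + 1 - q = p + 1 by omega] at this
  rw [← this]
  symm
  apply Finset.sum_subset
  · intro i hi; simp at hi ⊢; omega
  · intro i _ hi
    simp at hi
    by_cases hq : i < q
    · exact h1 i hq
    · exact h2 i (by have := hi (by omega); omega)

theorem sum_local {t : ℕ → ℝ} (ht : StrictMono t) (p : ℕ) (hp : 1 ≤ p) (N q : ℕ)
    (h : q + p + 1 ≤ N) (x : ℝ) (h1 : t (q + p) ≤ x) (h2 : x ≤ t (q + p + 1)) (g : ℕ → ℝ) :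
    ∑ i : Fin N, g i * bspline t i p x
      = ∑ r ∈ Finset.range (p + 1), g (q + r) * bspline t (q + r) p x := by
  apply sum_restrict N q p h (fun i => g i * bspline t i p x)
  · intro i hi
    rw [bs_zero_right ht p i x ((ht.monotone (by omega)).trans h1), mul_zero]
  · intro i hi
    rcases (h2.trans (ht.monotone (show q + p + 1 ≤ i by omega))).lt_or_eq with h | h
    · rw [bs_zero_left ht p i x h, mul_zero]
    · rw [h, bs_zero_knot ht p hp, mul_zero]

theorem local_indep {t : ℕ → ℝ} (ht : StrictMono t) (p : ℕ) (hp : 1 ≤ p) (q : ℕ) (g : ℕ → ℝ)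
    (hg : ∀ x ∈ Set.Icc (t (q + p)) (t (q + p + 1)),
      ∑ r ∈ Finset.range (p + 1), g r * bspline t (q + r) p x = 0) :
    ∀ r, r ≤ p → g r = 0 := by
  have hlt : t (q + p) < t (q + p + 1) := ht (by omega)
  obtain ⟨S, hS, hcard⟩ := (Set.Icc_infinite hlt).exists_subset_card_eq (p + 1)
  let e : Fin (p + 1) ≃ S := (Finset.equivFinOfCardEq hcard).symm
  let y : Fin (p + 1) → ℝ := fun l => (e l : ℝ)
  have hy : Function.Injective y := Subtype.val_injective.comp e.injective
  have hyI : ∀ l, y l ∈ Set.Icc (t (q + p)) (t (q + p + 1)) := fun l => hS (e l).2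
  let A : Matrix (Fin (p + 1)) (Fin (p + 1)) ℝ := fun l r => bspline t (q + r) p (y l)
  have hsurj : Function.Surjective A.mulVecLin := by
    intro v
    let P := Lagrange.interpolate Finset.univ y v
    have hPd : P.degree ≤ (p : ℕ) := by
      have := Lagrange.degree_interpolate_le (s := Finset.univ) (v := y) v hy.injOn
      refine this.trans (le_of_eq ?_)
      simp
    refine ⟨fun r => bsL t (q + r) p P, ?_⟩
    funext l
    have h1 : P.eval (y l) = v l :=
      Lagrange.eval_interpolate_at_node v hy.injOn (Finset.mem_univ l)
    rw [← h1, local_rep ht p hp q (y l) (hyI l).1 (hyI l).2 P hPd]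
    rw [Matrix.mulVecLin_apply, Matrix.mulVec, dotProduct,
      ← Fin.sum_univ_eq_sum_range (fun r => bsL t (q + r) p P * bspline t (q + r) p (y l))]
    exact Finset.sum_congr rfl fun r _ => mul_comm _ _
  have hinj := LinearMap.injective_iff_surjective.2 hsurj
  have h0 : A.mulVecLin (fun r => g r) = A.mulVecLin 0 := by
    rw [map_zero]
    funext l
    rw [Matrix.mulVecLin_apply, Matrix.mulVec, dotProduct, Pi.zero_apply, ← hg (y l) (hyI l),
      ← Fin.sum_univ_eq_sum_range (fun r => g r * bspline t (q + r) p (y l))]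
    exact Finset.sum_congr rfl fun r _ => mul_comm _ _
  intro r hr
  exact congrFun (hinj h0) ⟨r, by omega⟩

theorem exists_interval (t : ℕ → ℝ) (a : ℕ) (x : ℝ) (h1 : t a ≤ x) (b : ℕ) (hab : a < b)
    (h2 : x ≤ t b) : ∃ j, a ≤ j ∧ j < b ∧ t j ≤ x ∧ x ≤ t (j + 1) := by
  induction b, hab using Nat.le_induction with
  | base => exact ⟨a, le_rfl, by omega, h1, h2⟩
  | succ b hb ih =>
    rcases le_total (t b) x with h | h
    · exact ⟨b, by omega, by omega, h, h2⟩
    · obtain ⟨j, h3, h4, h5, h6⟩ := ih h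
      exact ⟨j, h3, by omega, h5, h6⟩

theorem curry_strictMono (m p : ℕ) (hp : 1 ≤ p) (hpm : 2 * p < m)
    (t : ℕ → ℝ) (ht : StrictMono t)
    (s : ℝ → ℝ)
    (hs_smooth : ContDiffOn ℝ (p - 1 : ℕ) s (Set.Icc (t p) (t (m - p))))
    (hs_poly : ∀ j : ℕ, p ≤ j → j < m - p →
      ∃ P : Polynomial ℝ, P.degree ≤ (p : ℕ) ∧
        ∀ x ∈ Set.Icc (t j) (t (j + 1)), s x = P.eval x) :
    ∃! α : Fin (m - p) → ℝ,
      ∀ x ∈ Set.Icc (t p) (t (m - p)),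
        s x = ∑ i : Fin (m - p), α i * bspline t i p x := by
  choose! P hPd hPs using hs_poly
  have hstep : ∀ i j, p ≤ j → j + 1 < m - p → i ≤ j → j < i + p →
      bsL t i p (P (j + 1)) = bsL t i p (P j) := by
    intro i j h1 h2 h3 h4
    symm
    apply bsL_eq_of_dvd t i p (j + 1) (by omega) (by omega) _ _ (hPd j h1 (by omega))
      (hPd (j + 1) (by omega) h2)
    have := dvd_of_contDiffOn (t j) (t (j + 1)) (t (j + 1 + 1)) (ht (by omega)) (ht (by omega))
      (p - 1) s (P j) (P (j + 1))
      (hs_smooth.mono (Set.Icc_subset_Icc (ht.monotone h1) (ht.monotone (by omega))))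
      (hPs j h1 (by omega)) (hPs (j + 1) (by omega) h2)
    rwa [Nat.sub_add_cancel hp] at this
  have hcons : ∀ i j, p ≤ j → j < m - p → i ≤ j → j ≤ i + p →
      bsL t i p (P j) = bsL t i p (P (max i p)) := by
    intro i j h1 h2 h3
    have h5 : max i p ≤ j := max_le h3 h1
    induction j, h5 using Nat.le_induction with
    | base => intro _; rfl
    | succ j hj ih =>
      intro h4
      have hi : i ≤ j := (le_max_left _ _).trans hj
      have hpj : p ≤ j := (le_max_right _ _).trans hj
      rw [hstep i j hpj h2 hi (by omega)]
      exact ih hpj (by omega) hi (by omega)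
  refine ⟨fun i => bsL t i p (P (max i p)), ?_, ?_⟩
  · intro x hx
    obtain ⟨j, h1, h2, h3, h4⟩ := exists_interval t p x hx.1 (m - p) (by omega) hx.2
    obtain ⟨q, rfl⟩ : ∃ q, j = q + p := ⟨j - p, by omega⟩
    have := sum_local ht p hp (m - p) q (by omega) x h3 h4 (fun i => bsL t i p (P (max i p)))
    simp only at this ⊢
    rw [this, hPs (q + p) h1 h2 x ⟨h3, h4⟩,
      local_rep ht p hp q x h3 h4 (P (q + p)) (hPd _ h1 h2)]
    apply Finset.sum_congr rfl
    intro r hr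
    have hr' : r ≤ p := by simp at hr; omega
    rw [hcons (q + r) (q + p) h1 h2 (by omega) (by omega)]
  · intro β hβ
    funext i
    have hi := i.2
    -- interval containing the support index
    have hq : ∃ q r, (i : ℕ) = q + r ∧ r ≤ p ∧ q + p + 1 ≤ m - p := by
      rcases le_total (i : ℕ) p with h | h
      · exact ⟨0, i, by omega, h, by omega⟩
      · exact ⟨i - p, p, by omega, le_rfl, by omega⟩
    obtain ⟨q, r, hir, hr, hqm⟩ := hq
    let b : ℕ → ℝ := fun k => if h : k < m - p then β ⟨k, h⟩ else 0
    have hb : ∀ k : Fin (m - p), b k = β k := fun k => by simp [b]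
    have hloc := local_indep ht p hp q (fun r => b (q + r) - bsL t (q + r) p (P (q + p))) (by
      intro x hx
      have hx' : x ∈ Set.Icc (t p) (t (m - p)) :=
        ⟨(ht.monotone (by omega)).trans hx.1, hx.2.trans (ht.monotone hqm)⟩
      have e1 := hβ x hx'
      have e2 := sum_local ht p hp (m - p) q hqm x hx.1 hx.2 b
      simp only [hb] at e2
      rw [e2, hPs (q + p) (by omega) (by omega) x hx,
        local_rep ht p hp q x hx.1 hx.2 (P (q + p)) (hPd _ (by omega) (by omega))] at e1
      simp only [sub_mul, Finset.sum_sub_distrib]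
      rw [e1, sub_self]) r hr
    rw [hcons (q + r) (q + p) (by omega) (by omega) (by omega) (by omega), ← hir, hb] at hloc
    linarith

/-- **B-splines are a basis for splines (Curry–Schoenberg, simple knots).**
Let `t 0 < t 1 < ⋯ < t m` be a strictly increasing knot vector and `p ≥ 1` with
`2p < m`.  Every function `s` on `[t p, t (m−p)]` that is `(p−1)`-times
continuously differentiable there and agrees with a polynomial of degree at most
`p` on each knot interval `[t j, t (j+1)]`, `p ≤ j ≤ m−p−1`, is on `[t p, t (m−p)]`
a linear combination `∑_{i=0}^{m−p−1} α i · B_{i,p}` of the B-spline basis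
functions for a *unique* choice of coefficients `α`; i.e. the restrictions of
`B_{0,p}, …, B_{m−p−1,p}` to `[t p, t (m−p)]` form a basis of this space of
splines. -/
theorem bspline_basis_curry_schoenberg (m p : ℕ) (hp : 1 ≤ p) (hpm : 2 * p < m)
    (t : ℕ → ℝ) (ht : ∀ j, j < m → t j < t (j + 1))
    (s : ℝ → ℝ)
    (hs_smooth : ContDiffOn ℝ (p - 1 : ℕ) s (Set.Icc (t p) (t (m - p))))
    (hs_poly : ∀ j : ℕ, p ≤ j → j < m - p →
      ∃ P : Polynomial ℝ, P.degree ≤ (p : ℕ) ∧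
        ∀ x ∈ Set.Icc (t j) (t (j + 1)), s x = P.eval x) :
    ∃! α : Fin (m - p) → ℝ,
      ∀ x ∈ Set.Icc (t p) (t (m - p)),
        s x = ∑ i : Fin (m - p), α i * bspline t i p x := by
  let u : ℕ → ℝ := fun j => if j ≤ m then t j else t m + ((j : ℝ) - m)
  have hu : ∀ j, j ≤ m → u j = t j := fun j hj => by simp [u, hj]
  have hmono : StrictMono u := by
    apply strictMono_nat_of_lt_succ
    intro j
    rcases lt_trichotomy j m with h | h | h
    · rw [hu j h.le, hu (j + 1) h]; exact ht j h
    · subst h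
      simp [u]
    · have h1 : ¬ j ≤ m := by omega
      have h2 : ¬ j + 1 ≤ m := by omega
      simp only [u, h1, h2, if_false]
      push_cast
      linarith
  have key := curry_strictMono m p hp hpm u hmono s
    (by rw [hu p (by omega), hu (m - p) (by omega)]; exact hs_smooth)
    (by
      intro j h1 h2
      rw [hu j (by omega), hu (j + 1) (by omega)]
      exact hs_poly j h1 h2)
  rw [hu p (by omega), hu (m - p) (by omega)] at key
  have hB : ∀ (i : Fin (m - p)) (x : ℝ), bspline u i p x = bspline t i p x := by
    intro i x
    have := i.2
    exact bs_congr hu p i (by omega) x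
  simpa only [hB] using key
end
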